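/- arXiv:math/0506630 — 5 statements merged into one kernel-verified Lean document; each statement's English description precedes it below -/
import Mathlib

section
/- (Orbi-analogue of the orbit counting lemma) Let G be a finite group acting on a finite A-weighted set (X, f) with f G-invariant. Then |G| · |X/^orb G|_f = Σ_{ḡ ∈ C(G)} |ḡ| · Σ_{h ∈ Z(g)} |X^g ∩ X^h|_f, where the outer sum is over conjugacy classes ḡ with chosen representative g, |ḡ| is the size of the conjugacy class, and |X^g ∩ X^h|_f = Σ_{x ∈ X^g ∩ X^h} f(x). -/
/-- The action of the centralizer `Z(g)` on the fixed-point set `X^g`. -/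
instance fixedSubAction {G Y : Type*} [Group G] [MulAction G Y] (g : G) :
    MulAction (Subgroup.centralizer ({g} : Set G)) {y : Y // g • y = y} where
  smul h y := ⟨(h : G) • (y : Y), by
    have hc : g * (h : G) = (h : G) * g :=
      (Subgroup.mem_centralizer_iff.mp h.2) g (Set.mem_singleton g)
    calc g • ((h : G) • (y : Y)) = (g * (h : G)) • (y : Y) := (mul_smul _ _ _).symm
      _ = ((h : G) * g) • (y : Y) := by rw [hc]
      _ = (h : G) • g • (y : Y) := mul_smul _ _ _
      _ = (h : G) • (y : Y) := by rw [y.2]⟩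
  one_smul y := Subtype.ext (one_smul _ _)
  mul_smul h k y := Subtype.ext (mul_smul (h : G) (k : G) (y : Y))

open scoped Classical in
/-- Weighted form of Burnside's lemma. -/
theorem MulAction.card_smul_sum_orbits_eq_sum_fixed {M H Y : Type*} [AddCommMonoid M] [Group H]
    [MulAction H Y] [Fintype H] [Fintype Y] (w : Y → M) (hw : ∀ (h : H) (y : Y), w (h • y) = w y) :
    Nat.card H • ∑ q : Quotient (MulAction.orbitRel H Y), w q.out =
      ∑ h : H, ∑ y : Y with h • y = y, w y := by
  have hout (y : Y) : w (Quotient.mk (MulAction.orbitRel H Y) y).out = w y := by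
    obtain ⟨h, hh⟩ := MulAction.orbitRel_apply.mp
      (Quotient.exact (Quotient.out_eq (Quotient.mk (MulAction.orbitRel H Y) y)))
    rw [← hh]
    exact hw h y
  have hcard (q : Quotient (MulAction.orbitRel H Y)) :
      ∑ y : Y with Quotient.mk (MulAction.orbitRel H Y) y = q,
        Fintype.card (MulAction.stabilizer H y) = Nat.card H := by
    induction q using Quotient.inductionOn with | _ b =>
    have hstab : ∀ y ∈ Finset.univ.filter
        (fun y ↦ Quotient.mk (MulAction.orbitRel H Y) y = Quotient.mk _ b),
        Fintype.card (MulAction.stabilizer H y) = Fintype.card (MulAction.stabilizer H b) := by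
      intro y hy
      exact Fintype.card_congr (MulAction.stabilizerEquivStabilizerOfOrbitRel
        (Quotient.exact (Finset.mem_filter.mp hy).2)).toEquiv
    rw [Finset.sum_congr rfl hstab, Finset.sum_const, Nat.card_eq_fintype_card,
      ← MulAction.card_orbit_mul_card_stabilizer_eq_card_group H b, smul_eq_mul]
    congr 1
    rw [Fintype.card_subtype]
    congr 1
    ext y
    simp [← MulAction.orbitRel_apply, Quotient.eq]
  calc Nat.card H • ∑ q : Quotient (MulAction.orbitRel H Y), w q.out
      = ∑ q : Quotient (MulAction.orbitRel H Y),
          ∑ y : Y with Quotient.mk (MulAction.orbitRel H Y) y = q,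
            Fintype.card (MulAction.stabilizer H y) • w y := by
        rw [Finset.smul_sum]
        refine Finset.sum_congr rfl fun q _ ↦ ?_
        rw [← hcard q, Finset.sum_smul]
        refine Finset.sum_congr rfl fun y hy ↦ ?_
        rw [← (Finset.mem_filter.mp hy).2, hout]
    _ = ∑ y : Y, Fintype.card (MulAction.stabilizer H y) • w y :=
        Finset.sum_fiberwise _ _ _
    _ = ∑ y : Y, ∑ h : H, if h • y = y then w y else 0 := by
        refine Finset.sum_congr rfl fun y _ ↦ ?_
        rw [← Finset.sum_filter, Finset.sum_const, Fintype.card_subtype]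
        rfl
    _ = ∑ h : H, ∑ y : Y with h • y = y, w y := by
        rw [Finset.sum_comm]
        simp only [Finset.sum_filter]

theorem ConjClasses.card_carrier_mk_mul_card_centralizer {G : Type*} [Group G] [Finite G] (g : G) :
    Nat.card (ConjClasses.mk g).carrier * Nat.card (Subgroup.centralizer ({g} : Set G)) =
      Nat.card G := by
  rw [Subgroup.nat_card_centralizer_nat_card_stabilizer, ← ConjAct.orbit_eq_carrier_conjClasses]
  exact Nat.card_prod _ _ ▸ Nat.card_congr
    (MulAction.orbitProdStabilizerEquivGroup (ConjAct G) g)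

/-- orbi-analogue of the orbit counting lemma.
For a finite group `G` acting on a finite `A`-weighted set `(X, f)` with `f`
`G`-invariant,
`|G| · |X/^orb G|_f = Σ_{ḡ ∈ C(G)} |ḡ| · Σ_{h ∈ Z(g)} |X^g ∩ X^h|_f`.
The orbiquotient `X/^orb G = ⊔_{ḡ} X^g/Z(g)` carries the induced weight
`f(x̄) = f(x)` (here computed on the chosen orbit representative `Quotient.out`,
which is legitimate since `f` is `G`-invariant). -/
theorem orbi_orbit_counting
    {A : Type*} [CommRing A] {G X : Type*} [Group G] [Fintype G] [Fintype X]
    [MulAction G X] (f : X → A) (hf : ∀ (g : G) (x : X), f (g • x) = f x)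
    (rep : ConjClasses G → G) (hrep : ∀ c, ConjClasses.mk (rep c) = c) :
    Nat.card G •
      (∑ᶠ y : (Σ c : ConjClasses G,
          Quotient (MulAction.orbitRel (Subgroup.centralizer ({rep c} : Set G))
            {x : X // rep c • x = x})),
        f (y.2.out : X)) =
    ∑ᶠ c : ConjClasses G, Nat.card (ConjClasses.carrier c) •
      ∑ᶠ h : Subgroup.centralizer ({rep c} : Set G),
        ∑ᶠ x ∈ ({x : X | rep c • x = x} ∩ {x : X | (h : G) • x = x}), f x := by
  classical
  have := Fintype.ofFinite (ConjClasses G)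
  rw [finsum_eq_sum_of_fintype, finsum_eq_sum_of_fintype, Fintype.sum_sigma, Finset.smul_sum]
  refine Finset.sum_congr rfl fun c _ ↦ ?_
  have hc := ConjClasses.card_carrier_mk_mul_card_centralizer (rep c)
  rw [hrep c] at hc
  rw [← hc, mul_smul, MulAction.card_smul_sum_orbits_eq_sum_fixed
    (H := Subgroup.centralizer ({rep c} : Set G)) (fun x : {x : X // rep c • x = x} ↦ f x)
    fun h x ↦ hf h x, finsum_eq_sum_of_fintype]
  congr 1
  refine Finset.sum_congr rfl fun h _ ↦ ?_
  rw [finsum_mem_eq_finite_toFinset_sum _ (Set.toFinite _)]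
  refine Finset.sum_bij (fun x _ ↦ (x : X)) ?_ (fun _ _ _ _ ↦ Subtype.ext) ?_ fun _ _ ↦ rfl
  · intro x hx
    have hh : h • x = x := by simpa using hx
    simpa using ⟨x.2, congrArg Subtype.val hh⟩
  · intro x hx
    obtain ⟨hg, hh⟩ : rep c • x = x ∧ (h : G) • x = x := by simpa using hx
    have hfix : h • (⟨x, hg⟩ : {x : X // rep c • x = x}) = ⟨x, hg⟩ := Subtype.ext hh
    exact ⟨⟨x, hg⟩, by simpa using hfix, rfl⟩
end

section
/- (Orbicycle index polynomial of the cyclic group) Let n be a positive integer and regard ℤ/nℤ as the group of translation permutations of ℤ/nℤ. Then, as an identity in the polynomial ring ℚ[y₁,…,y_n], (1/n) · Σ_{(r,s) ∈ (ℤ/nℤ)²} Π_{k=1}^{n} y_k^{b_k(C(r) ∨ C(s))} = (1/n) · Σ_{d ∣ n} J₂(d) · y_d^{n/d}. (Since ℤ/nℤ is abelian, every conjugacy class is a singleton and the left side is exactly the orbicycle index polynomial P^orb_{ℤ_n}.) -/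
/-- The partition `C(x)` of `ℤ/nℤ` into the cycles of the translation
`a ↦ a + x`, as a setoid. -/
def translationPartition {n : ℕ} (x : ZMod n) : Setoid (ZMod n) :=
  AddAction.orbitRel (AddSubgroup.zmultiples x) (ZMod n)

/-- `b_k(π)`, the number of blocks of cardinality `k` of a partition
(setoid) `π`. -/
noncomputable def blockCount {M : Type*} (s : Setoid M) (k : ℕ) : ℕ :=
  Nat.card {B : Set M // B ∈ s.classes ∧ Nat.card B = k}

/-- The Jordan totient function
`J₂(m) = #{(x,y) ∈ (ℤ/mℤ)² : gcd(x, y, m) = 1}`. -/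
noncomputable def jordanTwo (m : ℕ) : ℕ :=
  Nat.card {p : ZMod m × ZMod m // Nat.gcd (Nat.gcd p.1.val p.2.val) m = 1}

/-- The cardinality of the subgroup generated by `r` and `s` in `ℤ/nℤ` is `n / gcd(r, s, n)`. -/
theorem card_zmultiples_sup {n : ℕ} [NeZero n] (r s : ZMod n) :
    Nat.card ↥(AddSubgroup.zmultiples r ⊔ AddSubgroup.zmultiples s) =
      n / Nat.gcd (Nat.gcd r.val s.val) n := by
  set g := Nat.gcd (Nat.gcd r.val s.val) n with hg
  have mem_of_dvd (t : ZMod n) (h : g ∣ t.val) :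
      t ∈ AddSubgroup.zmultiples (g : ZMod n) := by
    obtain ⟨c, hc⟩ := h
    refine AddSubgroup.mem_zmultiples_iff.2 ⟨c, ?_⟩
    rw [← ZMod.natCast_zmod_val t, hc]
    push_cast
    rw [zsmul_eq_mul, mul_comm]
    simp
  have key : AddSubgroup.zmultiples r ⊔ AddSubgroup.zmultiples s =
      AddSubgroup.zmultiples (g : ZMod n) := by
    apply le_antisymm
    · refine sup_le ?_ ?_ <;> rw [AddSubgroup.zmultiples_le] <;> apply mem_of_dvd
      · exact (Nat.gcd_dvd_left _ _).trans (Nat.gcd_dvd_left _ _)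
      · exact (Nat.gcd_dvd_left _ _).trans (Nat.gcd_dvd_right _ _)
    · rw [AddSubgroup.zmultiples_le]
      have h₁ := congrArg (Int.cast : ℤ → ZMod n) (Nat.gcd_eq_gcd_ab (Nat.gcd r.val s.val) n)
      have h₂ := congrArg (Int.cast : ℤ → ZMod n) (Nat.gcd_eq_gcd_ab r.val s.val)
      rw [← hg] at h₁
      push_cast at h₁ h₂
      rw [ZMod.natCast_self, zero_mul, add_zero] at h₁
      rw [ZMod.natCast_zmod_val, ZMod.natCast_zmod_val] at h₂
      rw [h₁, h₂, add_mul]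
      refine AddSubgroup.add_mem_sup ?_ ?_ <;> rw [mul_assoc, mul_comm, ← Int.cast_mul,
        ← zsmul_eq_mul] <;> exact AddSubgroup.zsmul_mem_zmultiples _ _
  rw [key, Nat.card_zmultiples, ZMod.addOrderOf_coe _ (NeZero.ne n),
    Nat.gcd_eq_right (Nat.gcd_dvd_right _ _)]

theorem translationPartition_sup {n : ℕ} (r s : ZMod n) :
    translationPartition r ⊔ translationPartition s =
      QuotientAddGroup.leftRel (AddSubgroup.zmultiples r ⊔ AddSubgroup.zmultiples s) := by
  have rel (x a b : ZMod n) :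
      translationPartition x a b ↔ a - b ∈ AddSubgroup.zmultiples x := by
    refine AddAction.orbitRel_apply.trans ⟨?_, fun h => ⟨⟨_, h⟩, sub_add_cancel a b⟩⟩
    rintro ⟨⟨u, hu⟩, rfl⟩
    simpa [AddSubgroup.vadd_def] using hu
  apply le_antisymm
  · refine sup_le ?_ ?_ <;> intro a b h <;> rw [rel, ← neg_mem_iff, neg_sub] at h <;>
      rw [QuotientAddGroup.leftRel_apply, neg_add_eq_sub]
    · exact (le_sup_left (a := AddSubgroup.zmultiples r)) h
    · exact (le_sup_right (a := AddSubgroup.zmultiples r)) h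
  · intro a b h
    rw [QuotientAddGroup.leftRel_apply, neg_add_eq_sub, AddSubgroup.mem_sup] at h
    obtain ⟨u, hu, v, hv, huv⟩ := h
    have h₁ : translationPartition r a (a + u) := by
      rw [rel, sub_add_cancel_left]
      exact neg_mem hu
    have h₂ : translationPartition s (a + u) b := by
      rw [rel, show a + u - b = -v by rw [eq_sub_iff_add_eq] at huv; rw [← huv]; abel]
      exact neg_mem hv
    exact Setoid.trans' _ ((le_sup_left : translationPartition r ≤ _) h₁)
      ((le_sup_right : translationPartition s ≤ _) h₂)

theorem blockCount_leftRel {A : Type*} [AddGroup A] (H : AddSubgroup A) (k : ℕ) :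
    blockCount (QuotientAddGroup.leftRel H) k = if k = Nat.card H then H.index else 0 := by
  have card_block : ∀ B ∈ (QuotientAddGroup.leftRel H).classes, Nat.card B = Nat.card H := by
    rintro _ ⟨a, rfl⟩
    refine Nat.card_congr
      { toFun x := ⟨-a + x, ?_⟩
        invFun h := ⟨a + h, ?_⟩
        left_inv x := by simp
        right_inv h := by simp }
    · exact QuotientAddGroup.leftRel_apply.1 (Setoid.symm' _ x.2)
    · exact Setoid.symm' _ (QuotientAddGroup.leftRel_apply.2 (by simp))
  unfold blockCount
  split_ifs with hk
  · rw [AddSubgroup.index, HasQuotient.Quotient, QuotientAddGroup.instHasQuotientAddSubgroup,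
      Nat.card_congr (Setoid.quotientEquivClasses (QuotientAddGroup.leftRel H))]
    refine Nat.card_congr (Equiv.subtypeEquivRight fun B => ?_)
    exact and_iff_left_of_imp fun hB => (card_block B hB).trans hk.symm
  · have : IsEmpty {B : Set A // B ∈ (QuotientAddGroup.leftRel H).classes ∧ Nat.card B = k} :=
      ⟨fun B => hk (B.2.2.symm.trans (card_block B B.2.1))⟩
    exact Nat.card_of_isEmpty

theorem jordanTwo_eq_card_gcd_eq {d m : ℕ} (hd : 0 < d) (hm : 0 < m) :
    jordanTwo d = Nat.card {p : ZMod (d * m) × ZMod (d * m) //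
      Nat.gcd (Nat.gcd p.1.val p.2.val) (d * m) = m} := by
  have : NeZero d := ⟨hd.ne'⟩
  have : NeZero (d * m) := ⟨(Nat.mul_pos hd hm).ne'⟩
  have val_scale (x : ZMod d) : ((x.val * m : ℕ) : ZMod (d * m)).val = x.val * m :=
    ZMod.val_cast_of_lt (Nat.mul_lt_mul_of_pos_right x.val_lt hm)
  have scale_inj {x y : ZMod d}
      (h : ((x.val * m : ℕ) : ZMod (d * m)) = ((y.val * m : ℕ) : ZMod (d * m))) : x = y := by
    have h := congrArg ZMod.val h
    rw [val_scale, val_scale] at h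
    exact ZMod.val_injective d (Nat.eq_of_mul_eq_mul_right hm h)
  have scale_surj {t : ZMod (d * m)} (h : m ∣ t.val) :
      ∃ x : ZMod d, ((x.val * m : ℕ) : ZMod (d * m)) = t := by
    obtain ⟨c, hc⟩ := h
    have hcd : c < d := by
      have := t.val_lt
      rw [hc, mul_comm] at this
      exact Nat.lt_of_mul_lt_mul_right this
    refine ⟨(c : ZMod d), ?_⟩
    rw [ZMod.val_cast_of_lt hcd, mul_comm c m, ← hc, ZMod.natCast_zmod_val]
  have gcd_scale (x y : ZMod d) :
      Nat.gcd (Nat.gcd ((x.val * m : ℕ) : ZMod (d * m)).val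
        ((y.val * m : ℕ) : ZMod (d * m)).val) (d * m) = m ↔
      Nat.gcd (Nat.gcd x.val y.val) d = 1 := by
    rw [val_scale, val_scale, Nat.gcd_mul_right, Nat.gcd_mul_right, Nat.mul_eq_right hm.ne']
  refine Nat.card_congr (Equiv.ofBijective
    (fun p => ⟨(((p.1.1.val * m : ℕ) : ZMod (d * m)), ((p.1.2.val * m : ℕ) : ZMod (d * m))),
      (gcd_scale _ _).2 p.2⟩) ⟨?_, ?_⟩)
  · rintro ⟨⟨x, y⟩, hp⟩ ⟨⟨x', y'⟩, hp'⟩ h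
    simp only [Subtype.mk.injEq, Prod.mk.injEq] at h ⊢
    exact ⟨scale_inj h.1, scale_inj h.2⟩
  · rintro ⟨⟨t, u⟩, hp⟩
    have hm_dvd : m ∣ Nat.gcd t.val u.val := by
      conv_lhs => rw [← hp]
      exact Nat.gcd_dvd_left _ _
    obtain ⟨x, rfl⟩ := scale_surj (hm_dvd.trans (Nat.gcd_dvd_left _ _))
    obtain ⟨y, rfl⟩ := scale_surj (hm_dvd.trans (Nat.gcd_dvd_right _ _))
    exact ⟨⟨(x, y), (gcd_scale x y).1 hp⟩, rfl⟩

/-- `J₂(d)` counts the pairs generating the subgroup of order `d` of `ℤ/nℤ`. -/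
theorem jordanTwo_eq_card_fiber {n d : ℕ} (hn : 0 < n) (hd : d ∣ n) :
    jordanTwo d = Nat.card {p : ZMod n × ZMod n //
      n / Nat.gcd (Nat.gcd p.1.val p.2.val) n = d} := by
  obtain ⟨m, rfl⟩ := hd
  have hd := Nat.pos_of_mul_pos_right hn
  have hm := Nat.pos_of_mul_pos_left hn
  rw [jordanTwo_eq_card_gcd_eq hd hm]
  refine Nat.card_congr (Equiv.subtypeEquivRight fun p => ?_)
  have hg := Nat.gcd_dvd_right (Nat.gcd p.1.val p.2.val) (d * m)
  rw [Nat.div_eq_iff_eq_mul_left (Nat.pos_of_dvd_of_pos hg hn) hg, Nat.mul_right_inj hd.ne',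
    eq_comm]

theorem prod_pow_blockCount {n : ℕ} [NeZero n] (r s : ZMod n) :
    ∏ k ∈ Finset.Icc 1 n, (MvPolynomial.X k : MvPolynomial ℕ ℚ) ^
        blockCount (translationPartition r ⊔ translationPartition s) k =
      MvPolynomial.X (n / Nat.gcd (Nat.gcd r.val s.val) n) ^
        (n / (n / Nat.gcd (Nat.gcd r.val s.val) n)) := by
  have hcard := card_zmultiples_sup r s
  have hindex := (AddSubgroup.zmultiples r ⊔ AddSubgroup.zmultiples s).card_mul_index
  rw [hcard, Nat.card_zmod] at hindex
  set d := n / Nat.gcd (Nat.gcd r.val s.val) n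
  have hd : 0 < d := hcard ▸ Nat.card_pos
  rw [Finset.prod_eq_single_of_mem d (Finset.mem_Icc.2 ⟨hd, Nat.div_le_self _ _⟩)]
  · rw [translationPartition_sup, blockCount_leftRel, if_pos hcard.symm,
      Nat.eq_div_of_mul_eq_right hd.ne' hindex]
  · intro k _ hk
    rw [translationPartition_sup, blockCount_leftRel, hcard, if_neg hk, pow_zero]

/-- orbicycle index polynomial of the cyclic group.
In `ℚ[y₁, …, yₙ]` (variables `MvPolynomial.X k`),
`(1/n) Σ_{(r,s) ∈ (ℤ/nℤ)²} Π_{k=1}^n y_k^{b_k(C(r) ∨ C(s))}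
  = (1/n) Σ_{d ∣ n} J₂(d) y_d^{n/d}`. -/
theorem orbicycle_index_cyclic (n : ℕ) (hn : 0 < n) :
    ((n : ℚ)⁻¹ •
      ∑ᶠ rs : ZMod n × ZMod n,
        ∏ k ∈ Finset.Icc 1 n,
          (MvPolynomial.X k : MvPolynomial ℕ ℚ) ^
            blockCount (translationPartition rs.1 ⊔ translationPartition rs.2) k) =
    (n : ℚ)⁻¹ •
      ∑ d ∈ n.divisors, jordanTwo d •
        (MvPolynomial.X d : MvPolynomial ℕ ℚ) ^ (n / d) := by
  have : NeZero n := ⟨hn.ne'⟩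
  congr 1
  rw [finsum_eq_sum_of_fintype, ← Finset.sum_fiberwise_of_maps_to (t := n.divisors)
    (g := fun p : ZMod n × ZMod n => n / Nat.gcd (Nat.gcd p.1.val p.2.val) n)
    fun p _ => Nat.mem_divisors.2 ⟨Nat.div_dvd_of_dvd (Nat.gcd_dvd_right _ _), hn.ne'⟩]
  refine Finset.sum_congr rfl fun d hd => ?_
  rw [jordanTwo_eq_card_fiber hn (Nat.dvd_of_mem_divisors hd), Nat.card_eq_fintype_card,
    Fintype.card_subtype, ← Finset.sum_const]
  refine Finset.sum_congr rfl fun p hp => ?_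
  rw [prod_pow_blockCount, (Finset.mem_filter.1 hp).2]
end

section
/- Let i₁, …, i_m be nonnegative integers, not all zero, with n = i₁ + ⋯ + i_m. Give [m] the weight f(j) = x_j in the polynomial ring ℚ[x₁,…,x_m], let ℤ/nℤ act by rotation on the set of maps α : ℤ/nℤ → [m], with weight f̃(α) = Π_k f(α(k)), and form the weighted orbiquotient [m]^n/^orb ℤ/nℤ. Then the coefficient of the monomial x₁^{i₁} ⋯ x_m^{i_m} in |[m]^n/^orb ℤ/nℤ|_{f̃} equals (1/n) · Σ_{d ∣ gcd(i₁,…,i_m)} J₂(d) · (i₁/d + ⋯ + i_m/d)! / ((i₁/d)! ⋯ (i_m/d)!). -/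
/-- `ℤ/nℤ` (written multiplicatively) acts on maps `ℤ/nℤ → Y` by rotation:
`(s • α) k = α (k - s)`. -/
instance rotAction {n : ℕ} {Y : Type*} : MulAction (Multiplicative (ZMod n)) (ZMod n → Y) where
  smul s α := fun k => α (k - s.toAdd)
  one_smul α := by
    show (fun k => α (k - (1 : Multiplicative (ZMod n)).toAdd)) = α
    ext k; simp
  mul_smul s t α := by
    show (fun k => α (k - (s * t).toAdd)) = fun k => α (k - s.toAdd - t.toAdd)
    ext k
    rw [toAdd_mul, sub_sub]

theorem MvPolynomial.coeff_expand_sum_X_pow {m : ℕ} (i : Fin m → ℕ) {c d n : ℕ} (hd : d ≠ 0)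
    (hcd : c * d = n) (hn : n = ∑ j, i j) :
    coeff (Finsupp.equivFunOnFinite.symm i)
      (expand d ((∑ j, X j : MvPolynomial (Fin m) ℚ) ^ c)) =
    if d ∣ Finset.univ.gcd i then (Nat.multinomial Finset.univ fun j => i j / d : ℚ) else 0 := by
  split_ifs with h
  · have hdvd : ∀ j, d ∣ i j := fun j => (Finset.dvd_gcd_iff.mp h) j (Finset.mem_univ j)
    have hi : Finsupp.equivFunOnFinite.symm i =
        d • Finsupp.equivFunOnFinite.symm (fun j => i j / d) := by
      ext j
      simp [Nat.mul_div_cancel' (hdvd j)]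
    have hsum : ∑ j, i j / d = c := by
      rw [← Nat.sum_div fun j _ => hdvd j, ← hn, ← hcd, Nat.mul_div_cancel _ (Nat.pos_of_ne_zero hd)]
    have hcoeff := coeff_linearCombination_X_pow_of_fintype (R := ℚ) (fun _ : Fin m => 1)
      (Finsupp.equivFunOnFinite.symm fun j => i j / d) c
    simp only [one_smul, one_pow] at hcoeff
    rw [hi, coeff_expand_smul _ hd, hcoeff, if_pos
      ((Finsupp.sum_fintype _ _ fun _ => rfl).trans hsum),
      ← Finsupp.multinomial_of_support_subset (Finset.subset_univ _)]
    simp [Finsupp.prod]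
  · simp only [Finset.dvd_gcd_iff, Finset.mem_univ, true_implies, not_forall] at h
    obtain ⟨j, hj⟩ := h
    exact coeff_expand_of_not_dvd _ hj

theorem Function.periodic_and_periodic_iff_gcd {n : ℕ} [NeZero n] {Y : Type*} (α : ZMod n → Y)
    (a b : ZMod n) :
    Function.Periodic α a ∧ Function.Periodic α b ↔
      Function.Periodic α ((Nat.gcd (Nat.gcd a.val b.val) n : ℕ) : ZMod n) := by
  constructor
  · rintro ⟨ha, hb⟩
    have h1 : ((Nat.gcd (Nat.gcd a.val b.val) n : ℕ) : ZMod n) =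
        ((Nat.gcdA (Nat.gcd a.val b.val) n * Nat.gcdA a.val b.val : ℤ) : ZMod n) * a +
        ((Nat.gcdA (Nat.gcd a.val b.val) n * Nat.gcdB a.val b.val : ℤ) : ZMod n) * b := by
      have e1 := congrArg (Int.cast : ℤ → ZMod n) (Nat.gcd_eq_gcd_ab (Nat.gcd a.val b.val) n)
      have e2 := congrArg (Int.cast : ℤ → ZMod n) (Nat.gcd_eq_gcd_ab a.val b.val)
      push_cast [ZMod.natCast_zmod_val, ZMod.natCast_self] at e1 e2 ⊢
      rw [e1, e2]
      ring
    rw [h1]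
    exact (ha.int_mul _).add_period (hb.int_mul _)
  · intro h
    have key : ∀ x : ZMod n, Nat.gcd (Nat.gcd a.val b.val) n ∣ x.val → Function.Periodic α x := by
      rintro x ⟨t, ht⟩
      have hx : x = (t : ZMod n) * ((Nat.gcd (Nat.gcd a.val b.val) n : ℕ) : ZMod n) := by
        rw [← Nat.cast_mul, mul_comm, ← ht, ZMod.natCast_zmod_val]
      rw [hx]
      exact h.nat_mul t
    exact ⟨key a ((Nat.gcd_dvd_left _ _).trans (Nat.gcd_dvd_left _ _)),
      key b ((Nat.gcd_dvd_left _ _).trans (Nat.gcd_dvd_right _ _))⟩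

theorem ZMod.card_castHom_fiber {c d n : ℕ} [NeZero n] [NeZero c] (hcd : c * d = n) (l : ZMod c) :
    (Finset.univ.filter fun k : ZMod n =>
      ZMod.castHom (Dvd.intro d hcd) (ZMod c) k = l).card = d := by
  have hsurj := ZMod.castHom_surjective (Dvd.intro d hcd : c ∣ n)
  have h : ∑ l' : ZMod c, (Finset.univ.filter fun k : ZMod n =>
      ZMod.castHom (Dvd.intro d hcd) (ZMod c) k = l').card = n := by
    rw [← Finset.card_eq_sum_card_fiberwise fun _ _ => Finset.mem_coe.2 (Finset.mem_univ _)]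
    simp
  rw [Finset.sum_congr rfl fun l' _ =>
    AddMonoidHom.card_fiber_eq_of_mem_range _ (hsurj l') (hsurj l)] at h
  simp only [Finset.sum_const, Finset.card_univ, ZMod.card, smul_eq_mul] at h
  exact Nat.eq_of_mul_eq_mul_left (NeZero.pos c) (h.trans hcd.symm)

theorem ZMod.periodic_iff_factors_castHom {c n : ℕ} [NeZero n] (hc : c ∣ n) {Y : Type*}
    (α : ZMod n → Y) :
    Function.Periodic α (c : ZMod n) ↔
      ∃ β : ZMod c → Y, β ∘ ZMod.castHom hc (ZMod c) = α := by
  have : NeZero c := ⟨ne_zero_of_dvd_ne_zero (NeZero.ne n) hc⟩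
  constructor
  · refine fun h => ⟨fun l => α (l.val : ZMod n), funext fun k => ?_⟩
    obtain ⟨t, rfl⟩ := ZMod.natCast_zmod_surjective k
    simp only [Function.comp_apply, map_natCast, ZMod.val_natCast]
    conv_rhs => rw [← Nat.mod_add_div t c]
    push_cast
    rw [mul_comm]
    exact (h.nat_mul _ _).symm
  · rintro ⟨β, rfl⟩ k
    rw [Function.comp_apply, map_add, map_natCast, ZMod.natCast_self, add_zero,
      Function.comp_apply]

open Classical in
theorem sum_periodic_prod_X {c d n m : ℕ} [NeZero n] (hcd : c * d = n) :
    ∑ α : ZMod n → Fin m with Function.Periodic α (c : ZMod n),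
      ∏ k, (MvPolynomial.X (α k) : MvPolynomial (Fin m) ℚ) =
    MvPolynomial.expand d ((∑ j, MvPolynomial.X j) ^ c) := by
  have hc : c ∣ n := Dvd.intro d hcd
  have : NeZero c := ⟨ne_zero_of_dvd_ne_zero (NeZero.ne n) hc⟩
  have himage : (Finset.univ.filter fun α : ZMod n → Fin m => Function.Periodic α (c : ZMod n)) =
      Finset.univ.image fun β : ZMod c → Fin m => β ∘ ZMod.castHom hc (ZMod c) := by
    ext α
    rw [Finset.mem_filter_univ, ZMod.periodic_iff_factors_castHom hc]
    simp only [Finset.mem_image, Finset.mem_univ, true_and]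
  rw [himage, Finset.sum_image
    ((ZMod.castHom_surjective hc).injective_comp_right.injOn)]
  have hpow : (∑ j, MvPolynomial.X j : MvPolynomial (Fin m) ℚ) ^ c =
      ∑ β : ZMod c → Fin m, ∏ l, MvPolynomial.X (β l) := by
    have := Finset.prod_univ_sum (fun _ : ZMod c => (Finset.univ : Finset (Fin m)))
      (fun _ j => (MvPolynomial.X j : MvPolynomial (Fin m) ℚ))
    simpa using this
  rw [hpow, map_sum]
  refine Finset.sum_congr rfl fun β _ => ?_
  rw [map_prod, ← Finset.prod_fiberwise _ (ZMod.castHom hc (ZMod c))]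
  refine Finset.prod_congr rfl fun l _ => ?_
  rw [Finset.prod_congr rfl fun k hk => by
    rw [Function.comp_apply, (Finset.mem_filter.mp hk).2], Finset.prod_const,
    ZMod.card_castHom_fiber hcd, MvPolynomial.expand_X]

theorem card_gcd_eq_jordanTwo {c d n : ℕ} [NeZero n] (hcd : c * d = n) :
    (Finset.univ.filter fun p : ZMod n × ZMod n =>
      Nat.gcd (Nat.gcd p.1.val p.2.val) n = c).card =
    jordanTwo d := by
  classical
  have hn := NeZero.pos n
  have : NeZero c := ⟨by rintro rfl; simp at hcd; omega⟩
  have : NeZero d := ⟨by rintro rfl; simp at hcd; omega⟩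
  have hval : ∀ x : ZMod d, ((c * x.val : ℕ) : ZMod n).val = c * x.val := fun x =>
    ZMod.val_natCast_of_lt (hcd ▸ Nat.mul_lt_mul_of_pos_left x.val_lt (NeZero.pos c))
  have hinj : Function.Injective fun x : ZMod d => ((c * x.val : ℕ) : ZMod n) := fun x y h => by
    have := congrArg ZMod.val h
    simp only [hval] at this
    exact ZMod.val_injective d (Nat.eq_of_mul_eq_mul_left (NeZero.pos c) this)
  have hsurj : ∀ a : ZMod n, c ∣ a.val → ∃ x : ZMod d, ((c * x.val : ℕ) : ZMod n) = a := by
    rintro a ⟨t, ht⟩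
    have htd : t < d := Nat.lt_of_mul_lt_mul_left (ht ▸ hcd ▸ a.val_lt : c * t < c * d)
    exact ⟨t, by rw [ZMod.val_natCast_of_lt htd, ← ht, ZMod.natCast_zmod_val]⟩
  rw [jordanTwo, Nat.card_eq_fintype_card, Fintype.card_subtype]
  symm
  refine Finset.card_bij (fun p _ => (((c * p.1.val : ℕ) : ZMod n), ((c * p.2.val : ℕ) : ZMod n)))
    ?_ ?_ ?_
  · intro p hp
    simp only [Finset.mem_filter, Finset.mem_univ, true_and] at hp ⊢
    rw [hval, hval, ← hcd, Nat.gcd_mul_left, Nat.gcd_mul_left, hp, mul_one]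
  · intro p _ q _ h
    exact Prod.ext (hinj (congrArg Prod.fst h)) (hinj (congrArg Prod.snd h))
  · rintro ⟨a, b⟩ hp
    simp only [Finset.mem_filter, Finset.mem_univ, true_and] at hp
    obtain ⟨x, rfl⟩ := hsurj a
      (hp ▸ (Nat.gcd_dvd_left _ _).trans (Nat.gcd_dvd_left _ _))
    obtain ⟨y, rfl⟩ := hsurj b
      (hp ▸ (Nat.gcd_dvd_left _ _).trans (Nat.gcd_dvd_right _ _))
    refine ⟨(x, y), ?_, rfl⟩
    simp only [Finset.mem_filter, Finset.mem_univ, true_and]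
    rw [hval, hval, ← hcd, Nat.gcd_mul_left, Nat.gcd_mul_left] at hp
    exact Nat.eq_of_mul_eq_mul_left (NeZero.pos c) (hp.trans (mul_one c).symm)

open Classical in
theorem MulAction.card_mul_sum_orbits {H Y : Type*} [Group H] [MulAction H Y] [Fintype H]
    [Fintype Y] (w : Y → ℚ) (hw : ∀ (h : H) y, w (h • y) = w y) :
    (Fintype.card H : ℚ) * ∑ q : Quotient (MulAction.orbitRel H Y), w q.out =
      ∑ h : H, ∑ y : Y with h • y = y, w y := by
  simp_rw [Finset.sum_filter]
  rw [Finset.sum_comm]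
  have hstab : ∀ y : Y, (∑ h : H, if h • y = y then w y else 0) =
      Fintype.card (MulAction.stabilizer H y) * w y := fun y => by
    rw [← Finset.sum_filter, Finset.sum_const, nsmul_eq_mul, Fintype.card_subtype]
    simp [MulAction.mem_stabilizer_iff]
  rw [Finset.sum_congr rfl fun y _ => hstab y, ← Finset.sum_fiberwise _
    (fun y => (Quotient.mk (MulAction.orbitRel H Y) y)), Finset.mul_sum]
  refine Finset.sum_congr rfl fun q _ => ?_
  have horb : ∀ y, Quotient.mk (MulAction.orbitRel H Y) y = q ↔ y ∈ MulAction.orbit H q.out := by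
    intro y
    rw [← MulAction.orbitRel_apply]
    conv_lhs => rw [← q.out_eq]
    exact Quotient.eq
  have hterm : ∀ y ∈ Finset.univ.filter
      (fun y => Quotient.mk (MulAction.orbitRel H Y) y = q),
      (Fintype.card (MulAction.stabilizer H y) : ℚ) * w y =
        Fintype.card (MulAction.stabilizer H q.out) * w q.out := by
    intro y hy
    have hy' := (horb y).mp (Finset.mem_filter.mp hy).2
    obtain ⟨h, hh⟩ := hy'
    rw [Fintype.card_congr (MulAction.stabilizerEquivStabilizer hh.symm).toEquiv, ← hh]
    exact congrArg _ (hw h _)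
  rw [Finset.sum_congr rfl hterm, Finset.sum_const, nsmul_eq_mul, ← mul_assoc]
  congr 1
  rw [← MulAction.card_orbit_mul_card_stabilizer_eq_card_group H q.out, Nat.cast_mul,
    Fintype.card_subtype]
  simp only [horb]

theorem rotAction_smul_eq_self_iff {n : ℕ} {Y : Type*} (g : Multiplicative (ZMod n))
    (α : ZMod n → Y) : g • α = α ↔ Function.Periodic α g.toAdd := by
  constructor
  · intro h k
    have hk : α (k + g.toAdd - g.toAdd) = α (k + g.toAdd) := congrFun h (k + g.toAdd)
    rw [← hk, add_sub_cancel_right]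
  · exact fun h => funext fun k => h.sub_eq k

open Classical in
theorem natCast_mul_sum_orbits_fixedPoints {n : ℕ} [NeZero n] {Y : Type*} [Fintype Y]
    (w : (ZMod n → Y) → ℚ) (hw : ∀ (s : Multiplicative (ZMod n)) α, w (s • α) = w α)
    (g : Multiplicative (ZMod n))
    [Fintype (Quotient (MulAction.orbitRel
      (Subgroup.centralizer ({g} : Set (Multiplicative (ZMod n))))
      {α : ZMod n → Y // g • α = α}))] :
    (n : ℚ) * ∑ q : Quotient (MulAction.orbitRel
        (Subgroup.centralizer ({g} : Set (Multiplicative (ZMod n))))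
        {α : ZMod n → Y // g • α = α}), w q.out =
      ∑ b : ZMod n, ∑ α : ZMod n → Y with
        Function.Periodic α g.toAdd ∧ Function.Periodic α b, w α := by
  have htop : ∀ h, h ∈ Subgroup.centralizer ({g} : Set (Multiplicative (ZMod n))) :=
    fun h => Subgroup.mem_centralizer_iff.mpr fun _ _ => mul_comm _ _
  let e : Subgroup.centralizer ({g} : Set (Multiplicative (ZMod n))) ≃ ZMod n :=
    (Equiv.subtypeUnivEquiv htop).trans Multiplicative.toAdd
  have hcard : Fintype.card (Subgroup.centralizer ({g} : Set (Multiplicative (ZMod n)))) = n :=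
    (Fintype.card_congr e).trans (ZMod.card n)
  have hburnside := MulAction.card_mul_sum_orbits
    (H := Subgroup.centralizer ({g} : Set (Multiplicative (ZMod n))))
    (fun α : {α : ZMod n → Y // g • α = α} => w α) fun h α => hw h α
  rw [hcard] at hburnside
  refine Eq.trans (by convert! hburnside) (hburnside.trans <| Fintype.sum_equiv e _ _ fun h => ?_)
  rw [Finset.sum_filter, Finset.sum_filter]
  simp_rw [ite_and, ← rotAction_smul_eq_self_iff g]
  rw [← Finset.sum_filter, ← Finset.sum_subtype_eq_sum_filter, Finset.subtype_univ]
  refine Finset.sum_congr rfl fun α _ => ?_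
  have hiff : h • α = α ↔ Function.Periodic (α : ZMod n → Y) (e h) :=
    Subtype.ext_iff.trans (rotAction_smul_eq_self_iff _ _)
  by_cases hα : h • α = α
  · rw [if_pos hα, if_pos (hiff.mp hα)]
  · rw [if_neg hα, if_neg (mt hiff.mpr hα)]

theorem sum_gcd_eq_sum_jordanTwo {n : ℕ} [NeZero n] (F : ℕ → ℚ) :
    ∑ p : ZMod n × ZMod n, F (n / Nat.gcd (Nat.gcd p.1.val p.2.val) n) =
      ∑ d ∈ n.divisors, (jordanTwo d : ℚ) * F d := by
  have hn := NeZero.ne n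
  rw [← Finset.sum_fiberwise_of_maps_to (t := n.divisors)
    (g := fun p : ZMod n × ZMod n => n / Nat.gcd (Nat.gcd p.1.val p.2.val) n)
    fun p _ => Nat.mem_divisors.mpr ⟨Nat.div_dvd_of_dvd (Nat.gcd_dvd_right _ _), hn⟩]
  refine Finset.sum_congr rfl fun d hd => ?_
  have hdn := Nat.dvd_of_mem_divisors hd
  rw [Finset.sum_congr rfl fun p hp => by rw [(Finset.mem_filter.mp hp).2], Finset.sum_const,
    nsmul_eq_mul, ← card_gcd_eq_jordanTwo (Nat.div_mul_cancel hdn)]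
  congr 3
  ext p
  have hp := Nat.gcd_dvd_right (Nat.gcd p.1.val p.2.val) n
  simp only [Finset.mem_filter, Finset.mem_univ, true_and]
  constructor
  · intro h
    rw [← h, Nat.div_div_self hp hn]
  · intro h
    rw [h, Nat.div_div_self hdn hn]

/-- With `[m]` weighted by `f(j) = x_j ∈ ℚ[x₁,…,x_m]`,
`n = i₁ + ⋯ + i_m` (the `i_j` not all zero), and `ℤ/nℤ` acting by rotation on
maps `ℤ/nℤ → [m]`, the coefficient of `x₁^{i₁} ⋯ x_m^{i_m}` in
`|[m]^n/^orb ℤ/nℤ|_{f̃}` equals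
`(1/n) Σ_{d ∣ gcd(i₁,…,i_m)} J₂(d) (i₁/d + ⋯ + i_m/d)!/((i₁/d)! ⋯ (i_m/d)!)`. -/
theorem coeff_orbiquotient_cyclic
    {m : ℕ} (i : Fin m → ℕ) (hi : i ≠ 0) (n : ℕ) (hn : n = ∑ j, i j)
    (rep : ConjClasses (Multiplicative (ZMod n)) → Multiplicative (ZMod n))
    (hrep : ∀ c, ConjClasses.mk (rep c) = c) :
    MvPolynomial.coeff (Finsupp.equivFunOnFinite.symm i)
      (∑ᶠ y : (Σ c : ConjClasses (Multiplicative (ZMod n)),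
          Quotient (MulAction.orbitRel
            (Subgroup.centralizer ({rep c} : Set (Multiplicative (ZMod n))))
            {α : ZMod n → Fin m // rep c • α = α})),
        ∏ᶠ k : ZMod n,
          (MvPolynomial.X ((y.2.out : ZMod n → Fin m) k) : MvPolynomial (Fin m) ℚ)) =
    (n : ℚ)⁻¹ *
      ∑ d ∈ (Finset.univ.gcd i).divisors,
        (jordanTwo d : ℚ) * (Nat.multinomial Finset.univ fun j => i j / d) := by
  classical
  have hn0 : n ≠ 0 := by
    rintro rfl
    exact hi (funext fun j => Finset.sum_eq_zero_iff.mp hn.symm j (Finset.mem_univ j))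
  have : NeZero n := ⟨hn0⟩
  have hrepbij : Function.Bijective rep := by
    refine ⟨fun c c' h => by rw [← hrep c, h, hrep c'], fun g => ⟨ConjClasses.mk g, ?_⟩⟩
    exact isConj_iff_eq.mp (ConjClasses.mk_eq_mk_iff_isConj.mp (hrep _))
  obtain ⟨w, hwdef⟩ : ∃ w : (ZMod n → Fin m) → ℚ, ∀ α,
      MvPolynomial.coeff (Finsupp.equivFunOnFinite.symm i)
        (∏ k, (MvPolynomial.X (α k) : MvPolynomial (Fin m) ℚ)) = w α := ⟨_, fun _ => rfl⟩
  have hw : ∀ (s : Multiplicative (ZMod n)) α, w (s • α) = w α := fun s α => by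
    rw [← hwdef, ← hwdef]
    exact congrArg (MvPolynomial.coeff _) <| Fintype.prod_equiv (Equiv.subRight s.toAdd)
      _ _ fun _ => rfl
  have : Fintype (ConjClasses (Multiplicative (ZMod n))) := Fintype.ofFinite _
  have hgcd : Finset.univ.gcd i ∣ n :=
    hn ▸ Finset.dvd_sum fun j hj => Finset.gcd_dvd hj
  rw [eq_inv_mul_iff_mul_eq₀ (Nat.cast_ne_zero.mpr hn0), finsum_eq_sum_of_fintype,
    MvPolynomial.coeff_sum, Fintype.sum_sigma, Finset.mul_sum]
  simp_rw [finprod_eq_prod_of_fintype, hwdef]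
  refine (Finset.sum_congr rfl fun c _ =>
    natCast_mul_sum_orbits_fixedPoints w hw (rep c)).trans ?_
  rw [Fintype.sum_bijective (fun c => (rep c).toAdd) (Multiplicative.toAdd.bijective.comp hrepbij) _
      (fun a => ∑ b : ZMod n, ∑ α : ZMod n → Fin m with
        Function.Periodic α a ∧ Function.Periodic α b, w α) fun _ => rfl,
    ← Fintype.sum_prod_type']
  have hterm : ∀ p : ZMod n × ZMod n, ∑ α : ZMod n → Fin m with
      Function.Periodic α p.1 ∧ Function.Periodic α p.2, w α =
      (fun d => if d ∣ Finset.univ.gcd i then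
        (Nat.multinomial Finset.univ fun j => i j / d : ℚ) else 0)
        (n / Nat.gcd (Nat.gcd p.1.val p.2.val) n) := by
    intro p
    have hp := Nat.gcd_dvd_right (Nat.gcd p.1.val p.2.val) n
    have hcd := Nat.mul_div_cancel' hp
    simp_rw [Function.periodic_and_periodic_iff_gcd, ← hwdef]
    rw [← MvPolynomial.coeff_sum, sum_periodic_prod_X hcd,
      MvPolynomial.coeff_expand_sum_X_pow i (Nat.div_ne_zero_iff_of_dvd hp |>.mpr
        ⟨hn0, ne_zero_of_dvd_ne_zero hn0 hp⟩) hcd hn]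
  refine ((Finset.sum_congr rfl fun p _ => hterm p).trans
    (sum_gcd_eq_sum_jordanTwo fun d => if d ∣ Finset.univ.gcd i then
      (Nat.multinomial Finset.univ fun j => i j / d : ℚ) else 0)).trans ?_
  simp_rw [mul_ite, mul_zero]
  rw [← Finset.sum_filter]
  refine Finset.sum_congr ?_ fun _ _ => rfl
  ext d
  simp only [Finset.mem_filter, Nat.mem_divisors]
  exact ⟨fun h => ⟨h.2, ne_zero_of_dvd_ne_zero hn0 hgcd⟩, fun h => ⟨⟨h.1.trans hgcd, hn0⟩, h.1⟩⟩
end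

section
/- Let A be a commutative ℚ-algebra, (X, f) a finite A-weighted set, and G ⊆ S_m a permutation group acting on the set X^[m] of maps [m] → X with product weight f̃. Then |C^orb_n(X^[m]/^orb G)|_{f̃} = (1/n) · Σ_{d ∣ n} J₂(d) · ( (1/|G|) · Σ_{ḡ ∈ C(G)} |ḡ| · Σ_{h ∈ Z(g)} Π_{k ≥ 1} (|X|_{f^{dk}})^{b_k(C(g) ∨ C(h))} )^{n/d}, where |X|_{f^{dk}} = Σ_{x ∈ X} f(x)^{dk}. -/
/-- Permutations of `Fin m` act on maps `Fin m → X` by `g • α = α ∘ g⁻¹`. -/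
instance permFunAction {m : ℕ} {X : Type*} : MulAction (Equiv.Perm (Fin m)) (Fin m → X) where
  smul g α := α ∘ ⇑g⁻¹
  one_smul α := by
    show α ∘ ⇑(1 : Equiv.Perm (Fin m))⁻¹ = α
    ext i; simp
  mul_smul g h α := by
    show α ∘ ⇑(g * h)⁻¹ = (α ∘ ⇑h⁻¹) ∘ ⇑g⁻¹
    ext i; simp [mul_inv_rev]

/-- The partition `C(g)` of `Fin m` into the cycles (`⟨g⟩`-orbits) of a
permutation `g`, as a setoid. -/
def cyclePartition {m : ℕ} (g : Equiv.Perm (Fin m)) : Setoid (Fin m) :=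
  MulAction.orbitRel (Subgroup.zpowers g) (Fin m)

/-- Burnside's lemma for an invariant weight. -/
theorem finsum_orbit_weight {H Y A : Type*} [Group H] [Finite H] [Finite Y] [MulAction H Y]
    [AddCommGroup A] [Module ℚ A] (w : Y → A) (hw : ∀ (h : H) y, w (h • y) = w y) :
    ∑ᶠ q : Quotient (MulAction.orbitRel H Y), w q.out =
      (Nat.card H : ℚ)⁻¹ • ∑ᶠ h : H, ∑ᶠ y ∈ MulAction.fixedBy Y h, w y := by
  classical
  have := Fintype.ofFinite H
  have := Fintype.ofFinite Y
  have hH : (Nat.card H : ℚ) ≠ 0 := by simp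
  rw [eq_inv_smul_iff₀ hH, finsum_eq_sum_of_fintype, finsum_eq_sum_of_fintype]
  have h1 : ∀ h : H, ∑ᶠ y ∈ MulAction.fixedBy Y h, w y = ∑ y : Y, if h • y = y then w y else 0 := by
    intro h
    rw [finsum_eq_sum_of_fintype]
    refine Finset.sum_congr rfl fun y _ => ?_
    rw [finsum_eq_if]
    rfl
  simp only [h1]
  rw [Finset.sum_comm]
  have h2 : ∀ y : Y, (∑ h : H, if h • y = y then w y else 0) =
      (Nat.card (MulAction.stabilizer H y) : ℚ) • w y := by
    intro y
    rw [← Finset.sum_filter, Finset.sum_const, Nat.cast_smul_eq_nsmul, Nat.card_eq_fintype_card,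
      Fintype.card_subtype]
    rfl
  simp only [h2]
  rw [Finset.smul_sum,
    ← Finset.sum_fiberwise Finset.univ (fun y : Y => (⟦y⟧ : Quotient (MulAction.orbitRel H Y)))]
  refine Finset.sum_congr rfl fun q _ => ?_
  have : Nonempty (MulAction.orbit H q.out) := ⟨⟨_, MulAction.mem_orbit_self _⟩⟩
  have h3 : ∀ y : Y, (⟦y⟧ : Quotient (MulAction.orbitRel H Y)) = q ↔
      y ∈ MulAction.orbit H q.out := by
    intro y
    rw [← MulAction.orbitRel_apply, ← Quotient.eq, Quotient.out_eq]
  have h4 : ∀ y ∈ Finset.univ.filter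
      (fun y : Y => (⟦y⟧ : Quotient (MulAction.orbitRel H Y)) = q),
      (Nat.card (MulAction.stabilizer H y) : ℚ) • w y =
        ((Nat.card H : ℚ) / Nat.card (MulAction.orbit H q.out)) • w q.out := by
    intro y hy
    rw [Finset.mem_filter, h3] at hy
    have ho := MulAction.orbit_eq_iff.mpr hy.2
    obtain ⟨h, rfl⟩ := hy.2
    simp only at ho ⊢
    rw [hw]
    congr 1
    have hc := MulAction.card_orbit_mul_card_stabilizer_eq_card_group H (h • q.out)
    simp only [Fintype.card_eq_nat_card] at hc
    rw [ho] at hc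
    rw [← hc, Nat.cast_mul, mul_div_cancel_left₀]
    exact Nat.cast_ne_zero.mpr Nat.card_pos.ne'
  rw [Finset.sum_congr rfl h4, Finset.sum_const, ← Nat.cast_smul_eq_nsmul ℚ, smul_smul]
  congr 1
  have h5 : (Finset.univ.filter
      (fun y : Y => (⟦y⟧ : Quotient (MulAction.orbitRel H Y)) = q)).card =
        Nat.card (MulAction.orbit H q.out) := by
    rw [Nat.card_eq_fintype_card, Fintype.card_subtype]
    simp only [h3]
  rw [h5, mul_div_cancel₀]
  exact Nat.cast_ne_zero.mpr Nat.card_pos.ne'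

/-- The weight of an orbiquotient as a sum over pairs of commuting elements. -/
theorem finsum_orbiquotient {G Y A : Type*} [Group G] [Finite G] [Finite Y] [MulAction G Y]
    [AddCommGroup A] [Module ℚ A] (w : Y → A) (hw : ∀ (g : G) y, w (g • y) = w y)
    (rep : ConjClasses G → G) (hrep : ∀ c, ConjClasses.mk (rep c) = c) :
    ∑ᶠ z : (Σ c : ConjClasses G,
        Quotient (MulAction.orbitRel (Subgroup.centralizer ({rep c} : Set G))
          {y : Y // rep c • y = y})), w (z.2.out : Y) =
      (Nat.card G : ℚ)⁻¹ • ∑ᶠ c : ConjClasses G, Nat.card (ConjClasses.carrier c) •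
        ∑ᶠ h : Subgroup.centralizer ({rep c} : Set G),
          ∑ᶠ y ∈ {y : Y | rep c • y = y ∧ (h : G) • y = y}, w y := by
  classical
  have := Fintype.ofFinite (ConjClasses G)
  have := fun c : ConjClasses G => Fintype.ofFinite
    (Quotient (MulAction.orbitRel (Subgroup.centralizer ({rep c} : Set G))
      {y : Y // rep c • y = y}))
  rw [finsum_eq_sum_of_fintype, Fintype.sum_sigma, finsum_eq_sum_of_fintype, Finset.smul_sum]
  refine Finset.sum_congr rfl fun c _ => ?_
  have hb := finsum_orbit_weight (H := Subgroup.centralizer ({rep c} : Set G))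
    (Y := {y : Y // rep c • y = y}) (fun y => w (y : Y)) (fun h y => hw (h : G) y)
  rw [finsum_eq_sum_of_fintype] at hb
  rw [hb, ← Nat.cast_smul_eq_nsmul ℚ, smul_smul]
  congr 1
  · have hcard : Nat.card (ConjClasses.carrier c) *
        Nat.card (Subgroup.centralizer ({rep c} : Set G)) = Nat.card G := by
      rw [Subgroup.nat_card_centralizer_nat_card_stabilizer, ← congrArg ConjClasses.carrier (hrep c),
        ← ConjAct.orbit_eq_carrier_conjClasses, ← Nat.card_prod]
      exact Nat.card_congr (MulAction.orbitProdStabilizerEquivGroup (ConjAct G) (rep c))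
    rw [← hcard, Nat.cast_mul, mul_inv, mul_right_comm, inv_mul_cancel₀, one_mul]
    intro h0
    rw [Nat.cast_eq_zero] at h0
    exact Nat.card_pos.ne' (hcard.symm.trans (by rw [h0, zero_mul]))
  · refine finsum_congr fun h => ?_
    refine (finsum_mem_eq_of_bijOn (fun y : {y : Y // rep c • y = y} => (y : Y)) ⟨?_, ?_, ?_⟩
      fun _ _ => rfl)
    · intro y hy
      exact ⟨y.2, congrArg Subtype.val hy⟩
    · exact Subtype.val_injective.injOn
    · intro y hy
      exact ⟨⟨y, hy.1⟩, Subtype.ext hy.2, rfl⟩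

/-- In a commutative group, the sum over pairs of commuting elements is over all pairs. -/
theorem finsum_centralizer_of_comm {N A : Type*} [CommGroup N] [Finite N] [AddCommMonoid A]
    (F : N → N → A) (rep : ConjClasses N → N) (hrep : ∀ c, ConjClasses.mk (rep c) = c) :
    ∑ᶠ c : ConjClasses N, Nat.card (ConjClasses.carrier c) •
        ∑ᶠ h : Subgroup.centralizer ({rep c} : Set N), F (rep c) h = ∑ᶠ s, ∑ᶠ t, F s t := by
  have hbij : Function.Bijective rep := by
    refine ⟨fun a b h => ?_, fun s => ⟨ConjClasses.mk s, ?_⟩⟩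
    · rw [← hrep a, ← hrep b, h]
    · have := hrep (ConjClasses.mk s)
      rwa [ConjClasses.mk_eq_mk_iff_isConj, isConj_iff_eq] at this
  refine finsum_eq_of_bijective rep hbij fun c => ?_
  have hc : Nat.card (ConjClasses.carrier c) = 1 := by
    rw [Nat.card_eq_one_iff_unique]
    refine ⟨⟨fun a b => Subtype.ext ?_⟩, ⟨⟨rep c, ConjClasses.mem_carrier_iff_mk_eq.mpr (hrep c)⟩⟩⟩
    have h := (ConjClasses.mem_carrier_iff_mk_eq.mp a.2).trans
      (ConjClasses.mem_carrier_iff_mk_eq.mp b.2).symm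
    rwa [ConjClasses.mk_eq_mk_iff_isConj, isConj_iff_eq] at h
  rw [hc, one_smul]
  refine finsum_eq_of_bijective (fun h => (h : N)) ⟨Subtype.val_injective, fun t => ⟨⟨t, ?_⟩, rfl⟩⟩
    fun _ => rfl
  rw [Subgroup.mem_centralizer_singleton_iff]
  exact mul_comm _ _

/-- The weight of the set of maps that are constant on the blocks of a partition. -/
theorem finsum_prod_of_le_ker {M Y A : Type*} [Fintype M] [Finite Y] [CommSemiring A]
    (s : Setoid M) (w : Y → A) :
    ∑ᶠ β ∈ {β : M → Y | s ≤ Setoid.ker β}, ∏ i, w (β i) =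
      ∏ᶠ q : Quotient s, ∑ᶠ y, w y ^ Nat.card {i // (⟦i⟧ : Quotient s) = q} := by
  classical
  have := Fintype.ofFinite Y
  have := Fintype.ofFinite (Quotient s)
  simp only [finprod_eq_prod_of_fintype, finsum_eq_sum_of_fintype (α := Y)]
  rw [Finset.prod_univ_sum, Fintype.piFinset_univ, ← finsum_eq_sum_of_fintype]
  symm
  refine (finsum_mem_univ _).symm.trans
    (finsum_mem_eq_of_bijOn (fun (φ : Quotient s → Y) i => φ ⟦i⟧) ⟨?_, ?_, ?_⟩ ?_)
  · intro φ _ i j hij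
    exact congrArg φ (Quotient.sound hij)
  · intro φ _ ψ _ h
    funext q
    induction q using Quotient.inductionOn with
    | h i => exact congrFun h i
  · intro β hβ
    exact ⟨fun q => q.lift β fun i j hij => hβ hij, trivial, rfl⟩
  · intro φ _
    rw [← Finset.prod_fiberwise' Finset.univ (fun i => (⟦i⟧ : Quotient s)) (fun q => w (φ q))]
    refine Finset.prod_congr rfl fun q _ => ?_
    rw [Finset.prod_const, Nat.card_eq_fintype_card, Fintype.card_subtype]

theorem blockCount_eq_card_quotient {M : Type*} (s : Setoid M) (k : ℕ) :
    blockCount s k =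
      Nat.card {q : Quotient s // Nat.card {i // (⟦i⟧ : Quotient s) = q} = k} := by
  have e : ∀ q : Quotient s,
      Nat.card {i // (⟦i⟧ : Quotient s) = q} = Nat.card (s.quotientEquivClasses q : Set M) := by
    intro q
    induction q using Quotient.inductionOn with
    | h a =>
      rw [Setoid.quotientEquivClasses_mk_eq]
      exact Nat.card_congr (Equiv.subtypeEquivRight fun i => Quotient.eq)
  symm
  exact Nat.card_congr ((Equiv.subtypeEquiv s.quotientEquivClasses
    (p := fun q => Nat.card {i // (⟦i⟧ : Quotient s) = q} = k)
    (q := fun B : s.classes => Nat.card (B : Set M) = k) fun q => by rw [e]).trans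
      (Equiv.subtypeSubtypeEquivSubtypeInter _ fun B : Set M => Nat.card B = k))

theorem finprod_quotient_eq_finprod_blockCount {M A : Type*} [Finite M] [CommMonoid A]
    (s : Setoid M) (F : ℕ → A) :
    ∏ᶠ q : Quotient s, F (Nat.card {i // (⟦i⟧ : Quotient s) = q}) =
      ∏ᶠ k ∈ Set.Ici 1, F k ^ blockCount s k := by
  classical
  have := Fintype.ofFinite (Quotient s)
  have hb : ∀ k, blockCount s k = (Finset.univ.filter
      fun q : Quotient s => Nat.card {i // (⟦i⟧ : Quotient s) = q} = k).card := by
    intro k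
    rw [blockCount_eq_card_quotient, Nat.card_eq_fintype_card, Fintype.card_subtype]
  rw [finprod_eq_prod_of_fintype, Finset.prod_comp]
  simp only [hb]
  symm
  apply finprod_mem_eq_prod_of_inter_mulSupport_eq
  ext k
  simp only [Set.mem_inter_iff, Set.mem_Ici, Function.mem_mulSupport, Finset.coe_image,
    Finset.coe_univ, Set.image_univ, Set.mem_range, and_congr_left_iff]
  intro hk
  constructor
  · intro _
    by_contra hne
    refine hk ?_
    rw [Finset.filter_false_of_mem fun q _ hq => hne ⟨q, hq⟩, Finset.card_empty, pow_zero]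
  · rintro ⟨q, rfl⟩
    obtain ⟨a, rfl⟩ := Quotient.exists_rep q
    have : Nonempty {i // (⟦i⟧ : Quotient s) = ⟦a⟧} := ⟨⟨a, rfl⟩⟩
    exact Nat.card_pos

theorem smul_eq_iff_cyclePartition_le {m : ℕ} {X : Type*} (g : Equiv.Perm (Fin m))
    (α : Fin m → X) : g • α = α ↔ cyclePartition g ≤ Setoid.ker α := by
  constructor
  · intro h i j hij
    obtain ⟨⟨k, hk⟩, rfl⟩ := hij
    have hk' : k ∈ MulAction.stabilizer (Equiv.Perm (Fin m)) α :=
      (Subgroup.zpowers_le.mpr (MulAction.mem_stabilizer_iff.mpr h)) hk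
    have := congrFun (MulAction.mem_stabilizer_iff.mp hk') (k j)
    change α (k⁻¹ (k j)) = α (k j) at this
    rw [← Equiv.Perm.mul_apply, inv_mul_cancel, Equiv.Perm.one_apply] at this
    exact this.symm
  · intro h
    funext i
    exact h (show (cyclePartition g) (g⁻¹ i) i from
      ⟨⟨g⁻¹, inv_mem (Subgroup.mem_zpowers g)⟩, rfl⟩)

theorem rot_smul_eq_iff_leftRel_le {n : ℕ} {Y : Type*} (s t : Multiplicative (ZMod n))
    (β : ZMod n → Y) : (s • β = β ∧ t • β = β) ↔
      QuotientAddGroup.leftRel (AddSubgroup.closure {s.toAdd, t.toAdd}) ≤ Setoid.ker β := by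
  have hr : ∀ u : Multiplicative (ZMod n), u • β = β ↔ ∀ k, β (k - u.toAdd) = β k :=
    fun u => funext_iff
  constructor
  · rintro ⟨hs, ht⟩
    have key : ∀ u ∈ AddSubgroup.closure {s.toAdd, t.toAdd},
        Multiplicative.ofAdd u ∈ MulAction.stabilizer (Multiplicative (ZMod n)) β := by
      intro u hu
      have hle : AddSubgroup.closure {s.toAdd, t.toAdd} ≤
          Subgroup.toAddSubgroup' (MulAction.stabilizer (Multiplicative (ZMod n)) β) := by
        rw [AddSubgroup.closure_le]
        rintro v (rfl | rfl)
        · exact hs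
        · exact ht
      exact hle hu
    intro i j hij
    rw [QuotientAddGroup.leftRel_apply] at hij
    have := (hr _).mp (key _ hij) j
    simpa using this
  · intro h
    have key : ∀ u : Multiplicative (ZMod n),
        u.toAdd ∈ AddSubgroup.closure {s.toAdd, t.toAdd} → u • β = β := by
      intro u hu
      rw [hr]
      intro k
      refine h ?_
      rw [QuotientAddGroup.leftRel_apply]
      simpa using hu
    exact ⟨key _ (AddSubgroup.subset_closure (by simp)), key _ (AddSubgroup.subset_closure (by simp))⟩

theorem card_closure_pair {n : ℕ} (hn : 0 < n) (s t : ZMod n) :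
    Nat.card (AddSubgroup.closure {s, t}) = n / Nat.gcd (Nat.gcd s.val t.val) n := by
  have : NeZero n := ⟨hn.ne'⟩
  have h : AddSubgroup.closure {s, t} =
      AddSubgroup.zmultiples ((Nat.gcd s.val t.val : ℕ) : ZMod n) := by
    apply le_antisymm
    · rw [AddSubgroup.closure_le]
      have key : ∀ u : ZMod n, Nat.gcd s.val t.val ∣ u.val →
          u ∈ AddSubgroup.zmultiples ((Nat.gcd s.val t.val : ℕ) : ZMod n) := by
        intro u ⟨c, hc⟩
        refine AddSubgroup.mem_zmultiples_iff.mpr ⟨c, ?_⟩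
        rw [← ZMod.natCast_zmod_val u, hc]
        push_cast
        rw [zsmul_eq_mul, mul_comm]
        push_cast
        rfl
      rintro u (rfl | rfl)
      · exact key _ (Nat.gcd_dvd_left _ _)
      · exact key _ (Nat.gcd_dvd_right _ _)
    · rw [AddSubgroup.zmultiples_le]
      have hb := congrArg (Int.cast : ℤ → ZMod n) (Nat.gcd_eq_gcd_ab s.val t.val)
      push_cast at hb
      rw [ZMod.natCast_zmod_val, ZMod.natCast_zmod_val] at hb
      rw [hb, mul_comm s, mul_comm t, ← zsmul_eq_mul, ← zsmul_eq_mul]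
      exact add_mem (zsmul_mem (AddSubgroup.subset_closure (by simp)) _)
        (zsmul_mem (AddSubgroup.subset_closure (by simp)) _)
  rw [h, Nat.card_zmultiples, ZMod.addOrderOf_coe _ hn.ne', Nat.gcd_comm]

theorem card_pairs_gcd_eq_jordanTwo {n d : ℕ} (hn : 0 < n) (hd : d ∣ n) :
    Nat.card {p : ZMod n × ZMod n // n / Nat.gcd (Nat.gcd p.1.val p.2.val) n = d} =
      jordanTwo d := by
  obtain ⟨e, rfl⟩ := hd
  have hd0 : 0 < d := pos_of_mul_pos_left hn (Nat.zero_le _)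
  have he0 : 0 < e := pos_of_mul_pos_right hn (Nat.zero_le _)
  have : NeZero d := ⟨hd0.ne'⟩
  have : NeZero (d * e) := ⟨hn.ne'⟩
  have hval : ∀ x : ZMod d, ((x.val * e : ℕ) : ZMod (d * e)).val = x.val * e := fun x =>
    ZMod.val_natCast_of_lt (Nat.mul_lt_mul_of_pos_right (ZMod.val_lt x) he0)
  have hgcd : ∀ a b : ℕ, d * e / Nat.gcd (Nat.gcd (a * e) (b * e)) (d * e) = d ↔
      Nat.gcd (Nat.gcd a b) d = 1 := by
    intro a b
    rw [Nat.gcd_mul_right, Nat.gcd_mul_right, Nat.mul_div_mul_right _ _ he0]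
    constructor
    · intro h
      have h' := Nat.div_mul_cancel (Nat.gcd_dvd_right (Nat.gcd a b) d)
      rw [h] at h'
      exact Nat.eq_of_mul_eq_mul_left hd0 (by rw [h', mul_one])
    · intro h
      rw [h, Nat.div_one]
  symm
  refine Nat.card_eq_of_bijective (fun p => ⟨(((p.1.1.val * e : ℕ) : ZMod (d * e)),
    ((p.1.2.val * e : ℕ) : ZMod (d * e))), ?_⟩) ⟨?_, ?_⟩
  · simp only [hval]
    exact (hgcd _ _).mpr p.2
  · rintro ⟨⟨a, b⟩, _⟩ ⟨⟨a', b'⟩, _⟩ h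
    simp only [Subtype.mk.injEq, Prod.mk.injEq] at h ⊢
    have inj : ∀ x y : ZMod d,
        ((x.val * e : ℕ) : ZMod (d * e)) = ((y.val * e : ℕ) : ZMod (d * e)) → x = y := by
      intro x y hxy
      have := congrArg ZMod.val hxy
      rw [hval, hval] at this
      exact ZMod.val_injective d (Nat.eq_of_mul_eq_mul_right he0 this)
    exact ⟨inj _ _ h.1, inj _ _ h.2⟩
  · rintro ⟨⟨a, b⟩, h⟩
    simp only at h
    have hg : Nat.gcd (Nat.gcd a.val b.val) (d * e) = e := by
      have h' := Nat.div_mul_cancel (Nat.gcd_dvd_right (Nat.gcd a.val b.val) (d * e))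
      rw [h] at h'
      exact Nat.eq_of_mul_eq_mul_left hd0 h'
    have key : ∀ x : ZMod (d * e), e ∣ x.val →
        ∃ y : ZMod d, ((y.val * e : ℕ) : ZMod (d * e)) = x := by
      intro x ⟨c, hc⟩
      have hlt : c < d := by
        have := ZMod.val_lt x
        rw [hc, mul_comm] at this
        exact lt_of_mul_lt_mul_right this (Nat.zero_le _)
      refine ⟨(c : ZMod d), ?_⟩
      rw [ZMod.val_natCast_of_lt hlt, mul_comm c e, ← hc, ZMod.natCast_zmod_val]
    have hdvd : e ∣ Nat.gcd a.val b.val := (dvd_of_eq hg.symm).trans (Nat.gcd_dvd_left _ _)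
    obtain ⟨a', rfl⟩ := key a (hdvd.trans (Nat.gcd_dvd_left _ _))
    obtain ⟨b', rfl⟩ := key b (hdvd.trans (Nat.gcd_dvd_right _ _))
    refine ⟨⟨(a', b'), ?_⟩, rfl⟩
    rw [hval, hval] at h
    exact (hgcd _ _).mp h

/-- The weight of the necklaces fixed by two rotations. -/
theorem finsum_fixed_rotations {n : ℕ} [NeZero n] {Y A : Type*} [Finite Y] [CommSemiring A]
    (w : Y → A) (s t : Multiplicative (ZMod n)) {d : ℕ}
    (hd : n / Nat.gcd (Nat.gcd s.toAdd.val t.toAdd.val) n = d) :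
    ∑ᶠ β ∈ {β : ZMod n → Y | s • β = β ∧ t • β = β}, ∏ k, w (β k) =
      (∑ᶠ y, w y ^ d) ^ (n / d) := by
  set H := AddSubgroup.closure {s.toAdd, t.toAdd} with hH
  have hcard : Nat.card H = d := by rw [hH, card_closure_pair (NeZero.pos n), hd]
  simp only [rot_smul_eq_iff_leftRel_le]
  rw [finsum_prod_of_le_ker]
  have hfib : ∀ q : Quotient (QuotientAddGroup.leftRel H),
      Nat.card {i // (⟦i⟧ : Quotient (QuotientAddGroup.leftRel H)) = q} = d := by
    intro q
    induction q using Quotient.inductionOn with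
    | h a =>
      rw [← hcard]
      refine Nat.card_congr ((Equiv.addLeft (-a)).subtypeEquiv fun i => ?_)
      rw [eq_comm, Quotient.eq, QuotientAddGroup.leftRel_apply]
      rfl
  rw [← hH]
  simp only [hfib]
  have := Fintype.ofFinite (Quotient (QuotientAddGroup.leftRel H))
  rw [finprod_eq_prod_of_fintype, Finset.prod_const, Finset.card_univ, ← Nat.card_eq_fintype_card]
  congr 1
  have h1 := AddSubgroup.card_eq_card_quotient_mul_card_addSubgroup H
  rw [Nat.card_zmod, hcard] at h1
  have hd0 : 0 < d := by rw [← hcard]; exact Nat.card_pos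
  exact (Nat.div_eq_of_eq_mul_left hd0 h1).symm

/-- Grouping pairs of rotations by the order of the subgroup they generate. -/
theorem finsum_zmod_pairs {n : ℕ} [NeZero n] {A : Type*} [AddCommMonoid A] (F : ℕ → A) :
    ∑ᶠ s : Multiplicative (ZMod n), ∑ᶠ t : Multiplicative (ZMod n),
        F (n / Nat.gcd (Nat.gcd s.toAdd.val t.toAdd.val) n) =
      ∑ d ∈ n.divisors, jordanTwo d • F d := by
  classical
  have hpair : ∑ᶠ s : Multiplicative (ZMod n), ∑ᶠ t : Multiplicative (ZMod n),
        F (n / Nat.gcd (Nat.gcd s.toAdd.val t.toAdd.val) n) =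
      ∑ p : ZMod n × ZMod n, F (n / Nat.gcd (Nat.gcd p.1.val p.2.val) n) := by
    rw [Fintype.sum_prod_type, ← finsum_eq_sum_of_fintype]
    refine finsum_eq_of_bijective Multiplicative.toAdd Multiplicative.toAdd.bijective fun s => ?_
    rw [← finsum_eq_sum_of_fintype]
    exact finsum_eq_of_bijective Multiplicative.toAdd Multiplicative.toAdd.bijective fun t => rfl
  rw [hpair, ← Finset.sum_fiberwise_of_maps_to
    (g := fun p : ZMod n × ZMod n => n / Nat.gcd (Nat.gcd p.1.val p.2.val) n) (t := n.divisors)]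
  · refine Finset.sum_congr rfl fun d hd => ?_
    rw [← card_pairs_gcd_eq_jordanTwo (NeZero.pos n) (Nat.dvd_of_mem_divisors hd),
      Nat.card_eq_fintype_card, Fintype.card_subtype, ← Finset.sum_const]
    refine Finset.sum_congr rfl fun p hp => ?_
    rw [(Finset.mem_filter.mp hp).2]
  · intro p _
    exact Nat.mem_divisors.mpr ⟨Nat.div_dvd_of_dvd (Nat.gcd_dvd_right _ _), NeZero.ne n⟩

/-- For an `A`-weighted set `(X, f)` (`A` a commutative
`ℚ`-algebra) and `G ⊆ S_m` acting on `X^[m]` with product weight,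
`|C^orb_n(X^[m]/^orb G)|_{f̃} = (1/n) Σ_{d ∣ n} J₂(d)
((1/|G|) Σ_{ḡ} |ḡ| Σ_{h ∈ Z(g)} Π_{k ≥ 1} (|X|_{f^{dk}})^{b_k(C(g) ∨ C(h))})^{n/d}`. -/
theorem orbicycles_of_orbi_polya
    {A : Type*} [CommRing A] [Algebra ℚ A]
    {X : Type*} [Fintype X] (f : X → A)
    {m : ℕ} (G : Subgroup (Equiv.Perm (Fin m)))
    (n : ℕ) (hn : 0 < n)
    (repG : ConjClasses G → G) (hrepG : ∀ c, ConjClasses.mk (repG c) = c)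
    (repn : ConjClasses (Multiplicative (ZMod n)) → Multiplicative (ZMod n))
    (hrepn : ∀ c, ConjClasses.mk (repn c) = c) :
    (let Y : Type _ := Σ c : ConjClasses G,
        Quotient (MulAction.orbitRel (Subgroup.centralizer ({repG c} : Set G))
          {α : Fin m → X // repG c • α = α});
     let w : Y → A := fun y => ∏ i : Fin m, f ((y.2.out : Fin m → X) i);
     ∑ᶠ z : (Σ c' : ConjClasses (Multiplicative (ZMod n)),
        Quotient (MulAction.orbitRel
          (Subgroup.centralizer ({repn c'} : Set (Multiplicative (ZMod n))))
          {β : ZMod n → Y // repn c' • β = β})),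
       ∏ᶠ k : ZMod n, w ((z.2.out : ZMod n → Y) k)) =
    (n : ℚ)⁻¹ •
      ∑ d ∈ n.divisors, jordanTwo d •
        ((Nat.card G : ℚ)⁻¹ •
          (∑ᶠ c : ConjClasses G, Nat.card (ConjClasses.carrier c) •
            ∑ᶠ h : Subgroup.centralizer ({repG c} : Set G),
              ∏ᶠ k ∈ Set.Ici 1,
                (∑ x : X, f x ^ (d * k)) ^
                  blockCount
                    (cyclePartition ((repG c : G) : Equiv.Perm (Fin m)) ⊔
                      cyclePartition (((h : G) : Equiv.Perm (Fin m)))) k)) ^ (n / d) := by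
  set Y : Type _ := Σ c : ConjClasses G,
    Quotient (MulAction.orbitRel (Subgroup.centralizer ({repG c} : Set G))
      {α : Fin m → X // repG c • α = α})
  set w : Y → A := fun y => ∏ i : Fin m, f ((y.2.out : Fin m → X) i)
  have : NeZero n := ⟨hn.ne'⟩
  have hw : ∀ d : ℕ, ∑ᶠ y : Y, w y ^ d = (Nat.card G : ℚ)⁻¹ •
      (∑ᶠ c : ConjClasses G, Nat.card (ConjClasses.carrier c) •
        ∑ᶠ h : Subgroup.centralizer ({repG c} : Set G),
          ∏ᶠ k ∈ Set.Ici 1,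
            (∑ x : X, f x ^ (d * k)) ^
              blockCount
                (cyclePartition ((repG c : G) : Equiv.Perm (Fin m)) ⊔
                  cyclePartition (((h : G) : Equiv.Perm (Fin m)))) k) := by
    intro d
    have h := finsum_orbiquotient (G := G) (Y := Fin m → X) (fun α => ∏ i, f (α i) ^ d)
      (fun g α => Equiv.prod_comp (g : Equiv.Perm (Fin m))⁻¹ fun i => f (α i) ^ d) repG hrepG
    simp only [Finset.prod_pow] at h
    refine h.trans ?_
    congr 1
    refine finsum_congr fun c => ?_
    congr 1
    refine finsum_congr fun h => ?_
    have hset : {α : Fin m → X | repG c • α = α ∧ (h : G) • α = α} =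
        {α | cyclePartition ((repG c : G) : Equiv.Perm (Fin m)) ⊔
          cyclePartition (((h : G) : Equiv.Perm (Fin m))) ≤ Setoid.ker α} := by
      ext α
      simp only [Set.mem_ofPred_eq, sup_le_iff, ← smul_eq_iff_cyclePartition_le]
      rfl
    simp only [← Finset.prod_pow]
    rw [hset, finsum_prod_of_le_ker _ fun x => f x ^ d, ← finprod_quotient_eq_finprod_blockCount]
    simp only [finsum_eq_sum_of_fintype, pow_mul]
  simp only [← hw]
  rw [← finsum_zmod_pairs fun d => (∑ᶠ y : Y, w y ^ d) ^ (n / d)]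
  have h := finsum_orbiquotient (G := Multiplicative (ZMod n)) (Y := ZMod n → Y)
    (fun β => ∏ᶠ k, w (β k))
    (fun s β => finprod_comp_equiv (Equiv.subRight s.toAdd) (f := fun k => w (β k))) repn hrepn
  refine h.trans ?_
  rw [finsum_centralizer_of_comm (fun s t => ∑ᶠ β ∈ {β : ZMod n → Y | s • β = β ∧ t • β = β},
    ∏ᶠ k, w (β k)) repn hrepn]
  simp only [finprod_eq_prod_of_fintype]
  rw [Nat.card_congr Multiplicative.toAdd, Nat.card_zmod]
  congr 1
  exact finsum_congr fun s => finsum_congr fun t => finsum_fixed_rotations w s t rfl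
end

section
/- Let X be a finite set and g ∈ S_n a permutation of [n] with c_i(g) cycles of length i for each i. Then there is a bijection between the quotient of the fixed-point set (X^n)^g = {α : [n] → X : α ∘ g = α} by the action of the centralizer Z(g) ⊆ S_n, and the product Π_{i=1}^{n} (X^{c_i(g)}/S_{c_i(g)}) of the quotients of X^{c_i(g)} by the full symmetric groups permuting coordinates. Consequently |X^n/^orb S_n| = Σ_{ḡ ∈ C(S_n)} Π_{i=1}^{n} binom(|X| + c_i(g) − 1, c_i(g)), the sum over conjugacy classes of S_n. -/
/-- `c_k(g)`: the number of cycles of length `k` of a permutation. -/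
noncomputable def cycleCount {m : ℕ} (g : Equiv.Perm (Fin m)) (k : ℕ) : ℕ :=
  Nat.card {B : Set (Fin m) // B ∈ (cyclePartition g).classes ∧ Nat.card B = k}

section CycleClasses

variable {n : ℕ} (g : Equiv.Perm (Fin n))

/-- The cycle of `g` through `x`, as a set. -/
def cycleSet (x : Fin n) : Set (Fin n) := {y | cyclePartition g y x}

variable {g}

lemma mem_cycleSet_iff {x y : Fin n} : y ∈ cycleSet g x ↔ ∃ k : ℤ, (g ^ k) x = y := by
  constructor
  · rintro ⟨⟨_, k, rfl⟩, hk⟩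
    exact ⟨k, hk⟩
  · rintro ⟨k, hk⟩
    exact ⟨⟨g ^ k, k, rfl⟩, hk⟩

lemma self_mem_cycleSet (x : Fin n) : x ∈ cycleSet g x := (cyclePartition g).refl x

lemma cycleSet_eq_iff {x y : Fin n} : cycleSet g y = cycleSet g x ↔ y ∈ cycleSet g x := by
  constructor
  · intro h
    exact h ▸ self_mem_cycleSet y
  · intro h
    ext z
    exact ⟨fun hz => (cyclePartition g).trans hz h,
      fun hz => (cyclePartition g).trans hz ((cyclePartition g).symm h)⟩

lemma zpow_apply_mem_cycleSet (k : ℤ) (x : Fin n) : (g ^ k) x ∈ cycleSet g x :=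
  mem_cycleSet_iff.2 ⟨k, rfl⟩

lemma cycleSet_mem_classes (x : Fin n) : cycleSet g x ∈ (cyclePartition g).classes :=
  ⟨x, rfl⟩

lemma eq_cycleSet_of_mem {B : Set (Fin n)} (hB : B ∈ (cyclePartition g).classes) {x : Fin n}
    (hx : x ∈ B) : B = cycleSet g x := by
  obtain ⟨y, rfl⟩ := hB
  exact (cycleSet_eq_iff.2 hx).symm

lemma nonempty_of_mem_classes {B : Set (Fin n)} (hB : B ∈ (cyclePartition g).classes) :
    B.Nonempty := by
  obtain ⟨y, rfl⟩ := hB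
  exact ⟨y, self_mem_cycleSet y⟩

lemma card_cycleSet_pos (x : Fin n) : 0 < Nat.card (cycleSet g x) :=
  have : Nonempty (cycleSet g x) := ⟨⟨x, self_mem_cycleSet x⟩⟩
  Nat.card_pos

lemma card_cycleSet_le (x : Fin n) : Nat.card (cycleSet g x) ≤ n := by
  simpa using Finite.card_subtype_le (fun y => y ∈ cycleSet g x)

lemma card_cycleSet_eq_minimalPeriod (x : Fin n) :
    Nat.card (cycleSet g x) = Function.minimalPeriod (g • ·) x := by
  classical
  have := Fintype.ofFinite (MulAction.orbit (Subgroup.zpowers g) x)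
  rw [MulAction.minimalPeriod_eq_card, ← Nat.card_eq_fintype_card]
  rfl

lemma zpow_apply_eq_iff {x : Fin n} {k l : ℤ} :
    (g ^ k) x = (g ^ l) x ↔ (Nat.card (cycleSet g x) : ℤ) ∣ k - l := by
  rw [card_cycleSet_eq_minimalPeriod, ← MulAction.zpow_smul_eq_iff_minimalPeriod_dvd,
    Equiv.Perm.smul_def, sub_eq_neg_add, zpow_add, zpow_neg, Equiv.Perm.mul_apply,
    Equiv.Perm.inv_eq_iff_eq, eq_comm (a := (g ^ k) x), eq_comm]

/-- Any length-preserving rearrangement of the cycles of `g` is induced by an element of the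
centralizer of `g`. -/
lemma exists_mem_centralizer_apply_mem_cycleSet (p : Fin n → Fin n)
    (hp : ∀ x y, cycleSet g x = cycleSet g y → p x = p y)
    (hcard : ∀ x, Nat.card (cycleSet g (p x)) = Nat.card (cycleSet g x))
    (hinj : ∀ x y, cycleSet g (p x) = cycleSet g (p y) → cycleSet g x = cycleSet g y) :
    ∃ h ∈ Subgroup.centralizer ({g} : Set (Equiv.Perm (Fin n))),
      ∀ x, h x ∈ cycleSet g (p x) := by
  let b : Fin n → Fin n := fun x => (Quotient.mk (cyclePartition g) x).out
  have hb : ∀ x, cycleSet g (b x) = cycleSet g x := fun x =>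
    cycleSet_eq_iff.2 (Quotient.mk_out (s := cyclePartition g) x)
  have hbb : ∀ x y, cycleSet g x = cycleSet g y → b x = b y := fun x y hxy =>
    congrArg Quotient.out (Quotient.sound (s := cyclePartition g) (cycleSet_eq_iff.1 hxy))
  have hk : ∀ x, ∃ k : ℤ, (g ^ k) (b x) = x := fun x =>
    mem_cycleSet_iff.1 (cycleSet_eq_iff.1 (hb x).symm)
  choose k hk using hk
  have transfer : ∀ x (l m : ℤ), (g ^ l) (p x) = (g ^ m) (p x) ↔ (g ^ l) (b x) = (g ^ m) (b x) :=
    fun x l m => by rw [zpow_apply_eq_iff, zpow_apply_eq_iff, hcard, hb]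
  let f : Fin n → Fin n := fun x => (g ^ k x) (p x)
  have hf : ∀ x, f x ∈ cycleSet g (p x) := fun x => zpow_apply_mem_cycleSet _ _
  have f_inj : Function.Injective f := by
    intro x y hxy
    have hc : cycleSet g x = cycleSet g y := by
      apply hinj
      rw [← cycleSet_eq_iff.2 (hf x), ← cycleSet_eq_iff.2 (hf y), hxy]
    have : (g ^ k x) (p x) = (g ^ k y) (p x) := by
      conv_rhs => rw [hp x y hc]
      exact hxy
    rw [transfer, hk, hbb x y hc, hk] at this
    exact this
  refine ⟨Equiv.ofBijective f (Finite.injective_iff_bijective.1 f_inj), ?_, hf⟩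
  rw [Subgroup.mem_centralizer_singleton_iff]
  ext x : 1
  have hc : cycleSet g (g x) = cycleSet g x :=
    cycleSet_eq_iff.2 (by simpa using zpow_apply_mem_cycleSet (g := g) 1 x)
  change f (g x) = g (f x)
  have : (g ^ k (g x)) (p x) = (g ^ (1 + k x)) (p x) := by
    rw [transfer, ← hbb _ _ hc, hk, hbb _ _ hc, zpow_add, Equiv.Perm.mul_apply, hk, zpow_one]
  rw [zpow_add, zpow_one] at this
  simpa [f, hp _ _ hc] using this

lemma image_cycleSet {h : Equiv.Perm (Fin n)}
    (hh : h ∈ Subgroup.centralizer ({g} : Set (Equiv.Perm (Fin n)))) (x : Fin n) :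
    h '' cycleSet g x = cycleSet g (h x) := by
  have comm : ∀ (k : ℤ) y, h ((g ^ k) y) = (g ^ k) (h y) := fun k y => by
    have : Commute h g := Subgroup.mem_centralizer_singleton_iff.1 hh
    exact congrArg (fun f : Equiv.Perm (Fin n) => f y) (this.zpow_right k).eq
  ext y
  simp only [Set.mem_image, mem_cycleSet_iff]
  constructor
  · rintro ⟨_, ⟨k, rfl⟩, rfl⟩
    exact ⟨k, (comm k x).symm⟩
  · rintro ⟨k, rfl⟩
    exact ⟨_, ⟨k, rfl⟩, comm k x⟩

variable (g) in
/-- The cycles of `g` of length `k`. -/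
abbrev CyclesOfLength (k : ℕ) : Type :=
  {B : Set (Fin n) // B ∈ (cyclePartition g).classes ∧ Nat.card B = k}

namespace CyclesOfLength

/-- A point on a given cycle. -/
noncomputable def base {k : ℕ} (B : CyclesOfLength g k) : Fin n :=
  (nonempty_of_mem_classes B.2.1).some

lemma base_mem {k : ℕ} (B : CyclesOfLength g k) : B.base ∈ B.1 :=
  (nonempty_of_mem_classes B.2.1).some_mem

lemma cycleSet_base {k : ℕ} (B : CyclesOfLength g k) : cycleSet g B.base = B.1 :=
  (eq_cycleSet_of_mem B.2.1 B.base_mem).symm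

/-- A centralizing permutation moves cycles to cycles of the same length. -/
def permOfCentralizer {h : Equiv.Perm (Fin n)}
    (hh : h ∈ Subgroup.centralizer ({g} : Set (Equiv.Perm (Fin n)))) (k : ℕ) :
    Equiv.Perm (CyclesOfLength g k) where
  toFun B := ⟨h '' B.1, by
    obtain ⟨x, hx⟩ := nonempty_of_mem_classes B.2.1
    rw [eq_cycleSet_of_mem B.2.1 hx, image_cycleSet hh]
    exact cycleSet_mem_classes _, by
    rw [Nat.card_image_of_injective h.injective, B.2.2]⟩
  invFun B := ⟨(h⁻¹ : Equiv.Perm (Fin n)) '' B.1, by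
    obtain ⟨x, hx⟩ := nonempty_of_mem_classes B.2.1
    rw [eq_cycleSet_of_mem B.2.1 hx, image_cycleSet (inv_mem hh)]
    exact cycleSet_mem_classes _, by
    rw [Nat.card_image_of_injective (h⁻¹ : Equiv.Perm (Fin n)).injective, B.2.2]⟩
  left_inv B := Subtype.ext (by simp [Set.image_image])
  right_inv B := Subtype.ext (by simp [Set.image_image])

variable (g) in
/-- A numbering of the cycles of length `k`. -/
noncomputable def numbering (k : ℕ) : CyclesOfLength g k ≃ Fin (cycleCount g k) :=
  Finite.equivFin _

variable (g) in
/-- The length of the cycle through `x`, as an index starting from `0`. -/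
noncomputable def lengthIndex (x : Fin n) : Fin n :=
  ⟨Nat.card (cycleSet g x) - 1, by
    have := card_cycleSet_pos (g := g) x
    have := card_cycleSet_le (g := g) x
    omega⟩

variable (g) in
/-- The cycle through `x`. -/
noncomputable def through (x : Fin n) : CyclesOfLength g ((lengthIndex g x).1 + 1) :=
  ⟨cycleSet g x, cycleSet_mem_classes x, (Nat.sub_add_cancel (card_cycleSet_pos x)).symm⟩

lemma through_eq {β : Type*} (f : ∀ i : Fin n, CyclesOfLength g (i.1 + 1) → β)
    (i : Fin n) (B : CyclesOfLength g (i.1 + 1)) {x : Fin n} (hx : x ∈ B.1) :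
    f _ (through g x) = f i B := by
  obtain ⟨B, hB, hc⟩ := B
  obtain rfl := eq_cycleSet_of_mem hB hx
  obtain rfl : i = lengthIndex g x := by
    ext
    simp [lengthIndex, hc]
  rfl

end CyclesOfLength

end CycleClasses

lemma permFun_smul_apply {m : ℕ} {X : Type*} (g : Equiv.Perm (Fin m)) (α : Fin m → X)
    (x : Fin m) : (g • α) x = α (g⁻¹ x) := rfl

section Orbits

open CyclesOfLength

variable {n : ℕ} {X : Type*} {g : Equiv.Perm (Fin n)}

lemma apply_eq_of_mem_cycleSet (α : {α : Fin n → X // g • α = α}) {x y : Fin n}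
    (h : y ∈ cycleSet g x) : α.1 y = α.1 x := by
  obtain ⟨k, rfl⟩ := mem_cycleSet_iff.1 h
  have hk : g ^ (-k) ∈ MulAction.stabilizer (Equiv.Perm (Fin n)) α.1 :=
    zpow_mem (MulAction.mem_stabilizer_iff.2 α.2) _
  have := congrFun (MulAction.mem_stabilizer_iff.1 hk) x
  rwa [permFun_smul_apply, zpow_neg, inv_inv] at this

variable (g) in
/-- The values of a `g`-invariant map on the cycles of each length, up to reordering. -/
noncomputable def cycleValues (α : {α : Fin n → X // g • α = α}) (i : Fin n) :
    Quotient (MulAction.orbitRel (Equiv.Perm (Fin (cycleCount g (i.1 + 1))))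
      (Fin (cycleCount g (i.1 + 1)) → X)) :=
  Quotient.mk _ fun j => α.1 ((numbering g _).symm j).base

lemma cycleValues_surjective : Function.Surjective (cycleValues (X := X) g) := by
  intro w
  let f : ∀ i : Fin n, CyclesOfLength g (i.1 + 1) → X := fun i B => (w i).out (numbering g _ B)
  have hg : ∀ x, g⁻¹ x ∈ cycleSet g x := fun x => by
    simpa using zpow_apply_mem_cycleSet (g := g) (-1) x
  refine ⟨⟨fun x => f _ (through g x), funext fun x => through_eq f _ _ (hg x)⟩, funext fun i => ?_⟩
  rw [← Quotient.out_eq (w i), cycleValues]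
  congr 1
  funext j
  simpa [f] using through_eq f i _ (base_mem ((numbering g _).symm j))

lemma cycleValues_eq_of_smul
    (h : Subgroup.centralizer ({g} : Set (Equiv.Perm (Fin n))))
    (α : {α : Fin n → X // g • α = α}) : cycleValues g (h • α) = cycleValues g α := by
  funext i
  refine Quotient.sound ⟨(numbering g _).permCongr (permOfCentralizer h.2 _), funext fun j => ?_⟩
  change α.1 _ = α.1 (h.1⁻¹ _)
  apply apply_eq_of_mem_cycleSet
  set B := (numbering g _).symm j with hB
  have : ((numbering g _).permCongr (permOfCentralizer h.2 _))⁻¹ j =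
      numbering g _ ((permOfCentralizer h.2 _).symm B) := by
    rw [Equiv.Perm.inv_eq_iff_eq]
    simp [Equiv.permCongr_apply, hB]
  rw [this, Equiv.symm_apply_apply, ← image_cycleSet (inv_mem h.2), cycleSet_base]
  exact base_mem ((permOfCentralizer h.2 _).symm B)

lemma orbitRel_of_cycleValues_eq {α β : {α : Fin n → X // g • α = α}}
    (hαβ : cycleValues g α = cycleValues g β) :
    MulAction.orbitRel (Subgroup.centralizer ({g} : Set (Equiv.Perm (Fin n)))) _ α β := by
  have : ∀ i : Fin n, ∃ τ : Equiv.Perm (Fin (cycleCount g (i.1 + 1))),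
      τ • (fun j => β.1 ((numbering g (i.1 + 1)).symm j).base) =
        fun j => α.1 ((numbering g (i.1 + 1)).symm j).base := fun i =>
    Quotient.exact (congrFun hαβ i)
  choose τ hτ using this
  let σ : ∀ i : Fin n, Equiv.Perm (CyclesOfLength g (i.1 + 1)) := fun i =>
    (numbering g _).symm.permCongr (τ i)
  have hσ : ∀ i B, α.1 (σ i B).base = β.1 B.base := fun i B => by
    have := congrFun (hτ i) (τ i (numbering g _ B))
    simpa [permFun_smul_apply, σ, Equiv.permCongr_apply] using this.symm
  let p : Fin n → Fin n := fun x => (σ _ (through g x)).base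
  have hp : ∀ i (B : CyclesOfLength g (i.1 + 1)) x, x ∈ B.1 → p x = (σ i B).base :=
    fun i B x hx => through_eq (fun i B => (σ i B).base) i B hx
  have hcard : ∀ x, Nat.card (cycleSet g (p x)) = Nat.card (cycleSet g x) := fun x => by
    rw [cycleSet_base, (σ _ _).2.2, ← (through g x).2.2]
    rfl
  obtain ⟨h, hh, hmem⟩ := exists_mem_centralizer_apply_mem_cycleSet (g := g) p
    (fun x y hxy => hp _ (through g y) x (cycleSet_eq_iff.1 hxy)) hcard (by
      intro x y hxy
      have hi : lengthIndex g y = lengthIndex g x := by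
        ext
        simp only [lengthIndex]
        rw [← hcard x, ← hcard y, hxy]
      obtain ⟨B, hB⟩ : ∃ B : CyclesOfLength g ((lengthIndex g x).1 + 1), B.1 = cycleSet g y :=
        hi ▸ ⟨through g y, rfl⟩
      rw [hp _ (through g x) x (self_mem_cycleSet x), hp _ B y (hB ▸ self_mem_cycleSet y),
        cycleSet_base, cycleSet_base, Subtype.coe_inj, (σ _).apply_eq_iff_eq] at hxy
      rw [← hB, ← hxy]
      rfl)
  refine ⟨⟨h, hh⟩, Subtype.ext (funext fun y => ?_)⟩
  obtain ⟨x, rfl⟩ := h.surjective y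
  change β.1 (h⁻¹ (h x)) = α.1 (h x)
  rw [show h⁻¹ (h x) = x from h.symm_apply_apply x, apply_eq_of_mem_cycleSet α (hmem x), hσ]
  exact (apply_eq_of_mem_cycleSet β (base_mem (through g x))).symm

theorem nonempty_quotient_centralizer_equiv (g : Equiv.Perm (Fin n)) :
    Nonempty
      ((Quotient (MulAction.orbitRel
          (Subgroup.centralizer ({g} : Set (Equiv.Perm (Fin n))))
          {α : Fin n → X // g • α = α})) ≃
        (∀ i : Fin n,
          Quotient (MulAction.orbitRel (Equiv.Perm (Fin (cycleCount g (i.1 + 1))))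
            (Fin (cycleCount g (i.1 + 1)) → X)))) := by
  refine ⟨Equiv.ofBijective (Quotient.lift (cycleValues g) ?_) ⟨?_, ?_⟩⟩
  · rintro _ α ⟨h, rfl⟩
    exact cycleValues_eq_of_smul h α
  · rintro ⟨α⟩ ⟨β⟩ hαβ
    exact Quotient.sound (orbitRel_of_cycleValues_eq hαβ)
  · intro w
    obtain ⟨α, rfl⟩ := cycleValues_surjective w
    exact ⟨Quotient.mk _ α, rfl⟩

end Orbits

lemma map_univ_val_eq_iff_exists_perm {ι X : Type*} [Fintype ι] {f₁ f₂ : ι → X} :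
    Finset.univ.val.map f₁ = Finset.univ.val.map f₂ ↔ ∃ σ : Equiv.Perm ι, f₁ = f₂ ∘ σ := by
  classical
  constructor
  · intro h
    have e : ∀ y, Nonempty ({a // f₁ a = y} ≃ {a // f₂ a = y}) := fun y => by
      rw [← Fintype.card_eq, Fintype.card_subtype, Fintype.card_subtype]
      have := congrArg (Multiset.count y) h
      rw [Multiset.count_map, Multiset.count_map] at this
      simp only [eq_comm (a := y)] at this
      exact this
    exact ⟨Equiv.ofFiberEquiv fun y => (e y).some,
      funext fun a => (Equiv.ofFiberEquiv_map _ a).symm⟩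
  · rintro ⟨σ, rfl⟩
    rw [← Multiset.map_map, Multiset.map_univ_val_equiv]

lemma card_quotient_perm (X : Type*) [Fintype X] (m : ℕ) :
    Nat.card (Quotient (MulAction.orbitRel (Equiv.Perm (Fin m)) (Fin m → X))) =
      Nat.choose (Fintype.card X + m - 1) m := by
  classical
  let f : (Fin m → X) → Sym X m := fun α => ⟨Finset.univ.val.map α, by simp⟩
  rw [← Nat.multichoose_eq, ← Sym.card_sym_eq_multichoose, ← Nat.card_eq_fintype_card]
  refine Nat.card_congr (Equiv.ofBijective (Quotient.lift f ?_) ⟨?_, ?_⟩)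
  · rintro _ α ⟨τ, rfl⟩
    exact Subtype.ext (map_univ_val_eq_iff_exists_perm.2 ⟨τ⁻¹, rfl⟩)
  · rintro ⟨α⟩ ⟨β⟩ h
    have hmap : Finset.univ.val.map α = Finset.univ.val.map β := congrArg Subtype.val h
    obtain ⟨τ, hτ⟩ := map_univ_val_eq_iff_exists_perm.1 hmap
    exact Quotient.sound ⟨τ⁻¹, hτ.symm⟩
  · rintro ⟨s, hs⟩
    induction s using Quotient.inductionOn with
    | _ l =>
      obtain rfl : l.length = m := hs
      refine ⟨Quotient.mk _ l.get, Subtype.ext ?_⟩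
      change Multiset.map l.get Finset.univ.val = l
      rw [Fin.univ_val_map, List.ofFn_get]

/-- For `g ∈ S_n` with `c_i(g)` cycles of length `i`, the
quotient of the fixed-point set `(X^n)^g` by `Z(g)` is in bijection with
`Π_{i=1}^n X^{c_i(g)}/S_{c_i(g)}` (here indexed by `i : Fin n`, the factor
for cycle length `i+1`); consequently
`|X^n/^orb S_n| = Σ_{ḡ ∈ C(S_n)} Π_{i=1}^n binom(|X| + c_i(g) − 1, c_i(g))`. -/
theorem orbiquotient_symmetric_group
    {X : Type*} [Fintype X] (n : ℕ)
    (rep : ConjClasses (Equiv.Perm (Fin n)) → Equiv.Perm (Fin n))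
    (hrep : ∀ c, ConjClasses.mk (rep c) = c) :
    (∀ g : Equiv.Perm (Fin n),
      Nonempty
        ((Quotient (MulAction.orbitRel
            (Subgroup.centralizer ({g} : Set (Equiv.Perm (Fin n))))
            {α : Fin n → X // g • α = α})) ≃
          (∀ i : Fin n,
            Quotient (MulAction.orbitRel (Equiv.Perm (Fin (cycleCount g (i.1 + 1))))
              (Fin (cycleCount g (i.1 + 1)) → X))))) ∧
    Nat.card (Σ c : ConjClasses (Equiv.Perm (Fin n)),
        Quotient (MulAction.orbitRel
          (Subgroup.centralizer ({rep c} : Set (Equiv.Perm (Fin n))))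
          {α : Fin n → X // rep c • α = α})) =
      ∑ᶠ c : ConjClasses (Equiv.Perm (Fin n)),
        ∏ i ∈ Finset.Icc 1 n,
          Nat.choose (Fintype.card X + cycleCount (rep c) i - 1) (cycleCount (rep c) i) := by
  refine ⟨nonempty_quotient_centralizer_equiv, ?_⟩
  classical
  have := Fintype.ofFinite (ConjClasses (Equiv.Perm (Fin n)))
  rw [Nat.card_sigma, finsum_eq_sum_of_fintype]
  refine Finset.sum_congr rfl fun c _ => ?_
  obtain ⟨e⟩ := nonempty_quotient_centralizer_equiv (X := X) (rep c)
  rw [Nat.card_congr e, Nat.card_pi]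
  simp only [card_quotient_perm]
  rw [Fin.prod_univ_eq_prod_range (fun i => Nat.choose
      (Fintype.card X + cycleCount (rep c) (i + 1) - 1) (cycleCount (rep c) (i + 1))) n,
    Finset.range_eq_Ico, Finset.prod_Ico_add' (fun i => Nat.choose
      (Fintype.card X + cycleCount (rep c) i - 1) (cycleCount (rep c) i)), Nat.zero_add]
  rfl
end
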